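/- arXiv:1904.02212 — 3 statements merged into one kernel-verified Lean document; each statement's English description precedes it below -/
import Mathlib

section
/- For every fixed c ∈ (0,1) there exists a constant C > 0 such that for all n and d with 3 ≤ d, n·d even, and d + 2 ≤ (1-c)·n, the cardinality of G_{d,c}(n) satisfies log|G_{d,c}(n)| ≥ (1 - c·(d-1)/(d+1))·(d·n/2)·log(n/(d+1)) - C·d·n. -/
/-- The number of `k`-cliques (sets of `k` mutually adjacent vertices) in a graph. -/
noncomputable def cliqueCount {V : Type*} (G : SimpleGraph V) (k : ℕ) : ℕ :=
  Nat.card {t : Finset V // G.IsNClique k t}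

/-- A graph is `d`-regular: every vertex has degree exactly `d`. -/
def IsDRegular {V : Type*} (G : SimpleGraph V) (d : ℕ) : Prop :=
  ∀ v : V, (G.neighborSet v).ncard = d

/-- `G_{d,c}(n)`: the set of simple `d`-regular graphs on the labeled vertex set `Fin n`
with at least `c * T_max` triangles, where `T_max = (n/3) * choose d 2`. -/
noncomputable def Gdc (n d : ℕ) (c : ℝ) : Set (SimpleGraph (Fin n)) :=
  {G | IsDRegular G d ∧ c * ((n : ℝ) / 3 * (d.choose 2)) ≤ (cliqueCount G 3 : ℝ)}

open Finset in
/-- If every row and every column of a relation contains at most `d` points, and `4 * d` is at most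
the number of rows, then at least a `3 ^ (-n)` proportion of all permutations avoids it on `T`. -/
theorem card_perm_le_three_pow_mul_card_avoiding {α : Type*} [Fintype α] [DecidableEq α]
    (F : α → Finset α) (d : ℕ) (hrow : ∀ x, #(F x) ≤ d) (hcol : ∀ y, #{x | y ∈ F x} ≤ d)
    (hd : 4 * d ≤ Fintype.card α) (T : Finset α) :
    (Fintype.card α).factorial ≤ 3 ^ #T * #{σ : Equiv.Perm α | ∀ x ∈ T, σ x ∉ F x} := by
  induction T using Finset.induction_on with
  | empty => simp [Fintype.card_perm]
  | insert a T ha ih =>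
    set S : Finset (Equiv.Perm α) := {σ | ∀ x ∈ T, σ x ∉ F x} with hS
    set S' : Finset (Equiv.Perm α) := {σ | ∀ x ∈ insert a T, σ x ∉ F x} with hS'
    have hsub : S' ⊆ S := by
      intro σ hσ
      simp only [hS, hS', mem_filter, mem_univ, true_and] at hσ ⊢
      exact fun x hx => hσ x (mem_insert_of_mem hx)
    have hbad (σ : Equiv.Perm α) (hσ : σ ∈ S \ S') : σ a ∈ F a := by
      simp only [hS, hS', mem_sdiff, mem_filter, mem_univ, true_and, mem_insert] at hσ
      by_contra h
      refine hσ.2 fun x hx => ?_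
      rcases hx with rfl | hx
      exacts [h, hσ.1 x hx]
    let good (σ : Equiv.Perm α) : Finset α := {u | σ u ∉ F a ∧ σ a ∉ F u}
    have hgood (σ : Equiv.Perm α) : Fintype.card α - 2 * d ≤ #(good σ) := by
      have h1 : #{u | σ u ∈ F a} ≤ d := by
        refine le_trans ?_ (hrow a)
        exact card_le_card_of_injOn σ (fun u hu => by simpa using hu) σ.injective.injOn
      have h2 := hcol (σ a)
      have h3 : (univ : Finset α) ⊆
          good σ ∪ (({u | σ u ∈ F a} : Finset α) ∪ ({u | σ a ∈ F u} : Finset α)) := by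
        intro u _
        simp only [good, mem_union, mem_filter, mem_univ, true_and]
        tauto
      have h4 := (card_le_card h3).trans (card_union_le _ _)
      have h5 := card_union_le ({u | σ u ∈ F a} : Finset α) ({u | σ a ∈ F u} : Finset α)
      rw [card_univ] at h4
      omega
    have hcount : #((S \ S').sigma good) ≤ #(S' ×ˢ (univ : Finset α)) := by
      refine card_le_card_of_injOn (fun p => (p.1 * Equiv.swap a p.2, p.2)) ?_ ?_
      · rintro ⟨σ, u⟩ hp
        obtain ⟨hσ, hu⟩ := mem_sigma.1 (mem_coe.1 hp)
        have hσa := hbad σ hσ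
        simp only [good, mem_filter, mem_univ, true_and] at hu
        have hσS : ∀ x ∈ T, σ x ∉ F x := by
          simpa [hS] using (mem_sdiff.1 hσ).1
        simp only [hS', coe_product, Set.mem_prod, mem_coe, mem_filter, mem_univ, true_and,
          and_true]
        intro x hx
        rw [Equiv.Perm.mul_apply]
        by_cases hxa : x = a
        · subst hxa; rw [Equiv.swap_apply_left]; exact hu.1
        by_cases hxu : x = u
        · subst hxu; rw [Equiv.swap_apply_right]; exact hu.2
        rw [Equiv.swap_apply_of_ne_of_ne hxa hxu]
        exact hσS x ((mem_insert.1 hx).resolve_left hxa)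
      · rintro ⟨σ, u⟩ _ ⟨τ, v⟩ _ h
        simp only [Prod.mk.injEq] at h
        obtain ⟨h1, rfl⟩ := h
        rw [mul_right_cancel h1]
    rw [card_sigma, card_product, card_univ] at hcount
    have hsum : #(S \ S') * (Fintype.card α - 2 * d) ≤ ∑ σ ∈ S \ S', #(good σ) := by
      rw [← smul_eq_mul]
      exact card_nsmul_le_sum _ _ _ fun σ _ => hgood σ
    have hpos : 0 < Fintype.card α := Fintype.card_pos_iff.2 ⟨a⟩
    have hle : #(S \ S') ≤ 2 * #S' := by
      have h1 : Fintype.card α ≤ 2 * (Fintype.card α - 2 * d) := by omega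
      refine Nat.le_of_mul_le_mul_right ?_ hpos
      nlinarith [Nat.mul_le_mul_left #(S \ S') h1]
    have hcard := card_sdiff_add_card_eq_card hsub
    rw [card_insert_of_notMem ha, pow_succ, mul_assoc]
    exact ih.trans (Nat.mul_le_mul_left _ (by omega))

open Finset in
/-- The `k`-regular bipartite relations on `α`, given by their rows. -/
def regularRelations (α : Type*) [Fintype α] [DecidableEq α] (k : ℕ) :
    Finset (α → Finset α) :=
  {B | (∀ x, #(B x) = k) ∧ ∀ y, #{x | y ∈ B x} = k}

open Finset in
/-- Adding a permutation to a `k`-regular relation gives many `k + 1`-regular ones. -/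
theorem card_regularRelations_succ {α : Type*} [Fintype α] [DecidableEq α] (k : ℕ)
    (hk : 4 * k ≤ Fintype.card α) :
    #(regularRelations α k) * (Fintype.card α).factorial ≤
      #(regularRelations α (k + 1)) * ((k + 1) ^ Fintype.card α * 3 ^ Fintype.card α) := by
  let avoid (B : α → Finset α) : Finset (Equiv.Perm α) := {σ | ∀ x ∈ univ, σ x ∉ B x}
  have havoid (B : α → Finset α) (hB : B ∈ regularRelations α k) :
      (Fintype.card α).factorial ≤ 3 ^ Fintype.card α * #(avoid B) := by
    simp only [regularRelations, mem_filter, mem_univ, true_and] at hB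
    exact card_perm_le_three_pow_mul_card_avoiding B k (fun x => (hB.1 x).le)
      (fun y => (hB.2 y).le) hk univ
  let addPerm (p : Σ _ : α → Finset α, Equiv.Perm α) : α → Finset α :=
    fun x => insert (p.2 x) (p.1 x)
  have hmaps : ∀ p ∈ (regularRelations α k).sigma avoid, addPerm p ∈ regularRelations α (k + 1) := by
    rintro ⟨B, σ⟩ hp
    simp only [regularRelations, avoid, mem_sigma, mem_filter, mem_univ, true_and,
      forall_const] at hp
    obtain ⟨⟨hrow, hcol⟩, hσ⟩ := hp
    simp only [regularRelations, addPerm, mem_filter, mem_univ, true_and]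
    refine ⟨fun x => by rw [card_insert_of_notMem (hσ x), hrow], fun y => ?_⟩
    have : univ.filter (fun x => y ∈ insert (σ x) (B x)) =
        insert (σ.symm y) (univ.filter fun x => y ∈ B x) := by
      ext x
      simp [Equiv.eq_symm_apply, eq_comm]
    rw [this, card_insert_of_notMem, hcol]
    simpa using hσ (σ.symm y)
  have hfiber : ∀ B' ∈ regularRelations α (k + 1),
      #{p ∈ (regularRelations α k).sigma avoid | addPerm p = B'} ≤ (k + 1) ^ Fintype.card α := by
    intro B' hB'
    have hB' : ∀ x, #(B' x) = k + 1 := by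
      simp only [regularRelations, mem_filter, mem_univ, true_and] at hB'
      exact hB'.1
    have hpi : #(Fintype.piFinset B') = (k + 1) ^ Fintype.card α := by
      rw [Fintype.card_piFinset, prod_congr rfl fun x _ => hB' x, prod_const, card_univ]
    rw [← hpi]
    refine card_le_card_of_injOn (fun p x => p.2 x) ?_ ?_
    · rintro ⟨B, σ⟩ hp
      obtain ⟨-, rfl⟩ := mem_filter.1 (mem_coe.1 hp)
      simp [addPerm]
    · rintro ⟨B, σ⟩ hp ⟨C, τ⟩ hq h
      obtain ⟨hp, hpB⟩ := mem_filter.1 (mem_coe.1 hp)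
      obtain ⟨hq, hqB⟩ := mem_filter.1 (mem_coe.1 hq)
      obtain rfl : σ = τ := Equiv.ext fun x => congrFun h x
      have hσ : ∀ x, σ x ∉ B x := by simpa [avoid] using (mem_sigma.1 hp).2
      have hτ : ∀ x, σ x ∉ C x := by simpa [avoid] using (mem_sigma.1 hq).2
      obtain rfl : B = C := by
        funext x
        have := congrFun (hpB.trans hqB.symm) x
        simp only [addPerm] at this
        rw [← erase_insert (hσ x), this, erase_insert (hτ x)]
      rfl
  have hcard := card_le_mul_card_image_of_maps_to hmaps _ hfiber
  rw [card_sigma] at hcard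
  calc #(regularRelations α k) * (Fintype.card α).factorial
      = ∑ B ∈ regularRelations α k, (Fintype.card α).factorial := by simp
    _ ≤ ∑ B ∈ regularRelations α k, 3 ^ Fintype.card α * #(avoid B) := sum_le_sum havoid
    _ = 3 ^ Fintype.card α * ∑ B ∈ regularRelations α k, #(avoid B) := by rw [mul_sum]
    _ ≤ 3 ^ Fintype.card α * ((k + 1) ^ Fintype.card α * #(regularRelations α (k + 1))) :=
        Nat.mul_le_mul_left _ hcard
    _ = _ := by ring

open Finset in
/-- A lower bound for the number of `k`-regular bipartite relations. -/
theorem factorial_pow_le_card_regularRelations {α : Type*} [Fintype α] [DecidableEq α]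
    (d k : ℕ) (hkd : k ≤ d) (hd : 4 * d ≤ Fintype.card α) :
    (Fintype.card α).factorial ^ k ≤
      #(regularRelations α k) * (d ^ Fintype.card α * 3 ^ Fintype.card α) ^ k := by
  induction k with
  | zero =>
    have : (fun _ => ∅) ∈ regularRelations α 0 := by simp [regularRelations]
    simpa using ⟨_, this⟩
  | succ k ih =>
    have hstep := card_regularRelations_succ (α := α) k (by omega)
    have hpow : (k + 1) ^ Fintype.card α ≤ d ^ Fintype.card α := Nat.pow_le_pow_left hkd _
    set D := d ^ Fintype.card α * 3 ^ Fintype.card α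
    calc (Fintype.card α).factorial ^ (k + 1)
        ≤ #(regularRelations α k) * D ^ k * (Fintype.card α).factorial := by
          rw [pow_succ]; exact Nat.mul_le_mul_right _ (ih (by omega))
      _ = #(regularRelations α k) * (Fintype.card α).factorial * D ^ k := by ring
      _ ≤ #(regularRelations α (k + 1)) *
            ((k + 1) ^ Fintype.card α * 3 ^ Fintype.card α) * D ^ k :=
          Nat.mul_le_mul_right _ hstep
      _ ≤ #(regularRelations α (k + 1)) * D * D ^ k := by
          gcongr
          exact Nat.mul_le_mul_right _ hpow
      _ = _ := by ring

/-- The disjoint union of `m` cliques on `d + 1` vertices and the bipartite graph of a relation. -/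
def cliquesAndBipartite {α : Type*} (m d : ℕ) (B : α → Finset α) :
    SimpleGraph ((Fin m × Fin (d + 1)) ⊕ (α ⊕ α)) where
  Adj
    | Sum.inl p, Sum.inl q => p.1 = q.1 ∧ p.2 ≠ q.2
    | Sum.inr (Sum.inl x), Sum.inr (Sum.inr y) => y ∈ B x
    | Sum.inr (Sum.inr y), Sum.inr (Sum.inl x) => y ∈ B x
    | _, _ => False
  symm := ⟨by
    rintro (p | x | x) (q | y | y) h
    · exact ⟨h.1.symm, h.2.symm⟩
    all_goals exact h⟩
  loopless := ⟨by
    rintro (p | x | x) h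
    · exact h.2 rfl
    all_goals exact h⟩

theorem isDRegular_cliquesAndBipartite {α : Type*} [Fintype α] [DecidableEq α] (m d : ℕ)
    {B : α → Finset α} (hB : B ∈ regularRelations α d) :
    IsDRegular (cliquesAndBipartite m d B) d := by
  simp only [regularRelations, Finset.mem_filter, Finset.mem_univ, true_and] at hB
  rintro (⟨i, a⟩ | x | y)
  · have : (cliquesAndBipartite m d B).neighborSet (Sum.inl (i, a)) =
        (fun b => Sum.inl (i, b)) '' (({a}ᶜ : Finset (Fin (d + 1))) : Set (Fin (d + 1))) := by
      ext (⟨j, b⟩ | y | y) <;> simp [cliquesAndBipartite, SimpleGraph.neighborSet]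
      tauto
    rw [this, Set.ncard_image_of_injective _ (fun b b' h => by simpa using h),
      Set.ncard_coe_finset, Finset.card_compl]
    simp
  · have : (cliquesAndBipartite m d B).neighborSet (Sum.inr (Sum.inl x)) =
        (fun y => Sum.inr (Sum.inr y)) '' (B x : Set α) := by
      ext (⟨j, b⟩ | y | y) <;> simp [cliquesAndBipartite, SimpleGraph.neighborSet]
    rw [this, Set.ncard_image_of_injective _ (fun b b' h => by simpa using h),
      Set.ncard_coe_finset, hB.1]
  · have : (cliquesAndBipartite m d B).neighborSet (Sum.inr (Sum.inr y)) =
        (fun x => Sum.inr (Sum.inl x)) ''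
          ((Finset.univ.filter fun x => y ∈ B x : Finset α) : Set α) := by
      ext (⟨j, b⟩ | x | x) <;> simp [cliquesAndBipartite, SimpleGraph.neighborSet]
    rw [this, Set.ncard_image_of_injective _ (fun b b' h => by simpa using h),
      Set.ncard_coe_finset, hB.2]

theorem IsDRegular.comap_equiv {V W : Type*} {G : SimpleGraph V} {d : ℕ} (hG : IsDRegular G d)
    (e : W ≃ V) : IsDRegular (G.comap e) d := by
  intro v
  have : (G.comap e).neighborSet v = e ⁻¹' G.neighborSet (e v) := by
    ext w; simp [SimpleGraph.neighborSet]
  rw [this, Set.ncard_preimage_of_injective_subset_range e.injective (by simp), hG]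

theorem mul_choose_le_cliqueCount {α V : Type*} [Finite V] (m d k : ℕ) (hk : 0 < k)
    (B : α → Finset α) (e : V ≃ (Fin m × Fin (d + 1)) ⊕ (α ⊕ α)) :
    m * (d + 1).choose k ≤ cliqueCount ((cliquesAndBipartite m d B).comap e) k := by
  classical
  let f (i : Fin m) : Fin (d + 1) ↪ V :=
    ⟨fun a => e.symm (Sum.inl (i, a)), fun a b h => by simpa using h⟩
  have hf (i : Fin m) (a : Fin (d + 1)) : e (f i a) = Sum.inl (i, a) := e.apply_symm_apply _
  have hclique (i : Fin m) (t : Finset (Fin (d + 1))) (ht : t.card = k) :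
      ((cliquesAndBipartite m d B).comap e).IsNClique k (t.map (f i)) := by
    rw [SimpleGraph.isNClique_iff]
    refine ⟨?_, by rw [Finset.card_map, ht]⟩
    intro v hv w hw hvw
    simp only [Finset.coe_map, Set.mem_image] at hv hw
    obtain ⟨a, -, rfl⟩ := hv
    obtain ⟨b, -, rfl⟩ := hw
    have hab : a ≠ b := fun h => hvw (by rw [h])
    rw [SimpleGraph.comap_adj, hf, hf]
    exact ⟨rfl, hab⟩
  have hcard : Nat.card (Fin m × {t : Finset (Fin (d + 1)) // t.card = k}) =
      m * (d + 1).choose k := by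
    simp
  rw [cliqueCount, ← hcard]
  refine Nat.card_le_card_of_injective
    (fun p => ⟨p.2.1.map (f p.1), hclique p.1 p.2.1 p.2.2⟩) ?_
  rintro ⟨i, s, hs⟩ ⟨j, t, ht⟩ h
  simp only [Subtype.mk.injEq] at h
  have hij : i = j := by
    obtain ⟨a, ha⟩ := Finset.card_pos.1 (hs ▸ hk)
    have : f i a ∈ t.map (f j) := h ▸ Finset.mem_map_of_mem _ ha
    obtain ⟨b, -, hb⟩ := Finset.mem_map.1 this
    have hb' := congrArg e hb
    rw [hf, hf] at hb'
    exact (congrArg Prod.fst (Sum.inl_injective hb')).symm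
  subst hij
  obtain rfl := Finset.map_injective _ h
  rfl

/-- A `d`-regular graph has few representations as `m` cliques and a bipartite graph. -/
theorem card_representations_le {α V : Type*} [Fintype α] [Fintype V] (m d : ℕ)
    {G : SimpleGraph V} (hG : IsDRegular G d) :
    Nat.card {p : (V ≃ (Fin m × Fin (d + 1)) ⊕ (α ⊕ α)) × (α → Finset α) //
        (cliquesAndBipartite m d p.2).comap p.1 = G} ≤
      (Fintype.card V * d ^ d) ^ m * Fintype.card V ^ (2 * Fintype.card α) := by
  classical
  have hcard : Nat.card ((Fin m → Σ v : V, (Fin d → G.neighborSet v)) × (α ⊕ α → V)) =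
      (Fintype.card V * d ^ d) ^ m * Fintype.card V ^ (2 * Fintype.card α) := by
    have hdeg (v : V) : Fintype.card (G.neighborSet v) = d := by
      rw [← Nat.card_eq_fintype_card]; exact hG v
    rw [Nat.card_eq_fintype_card]
    simp only [Fintype.card_prod, Fintype.card_fun, Fintype.card_sigma, Fintype.card_fin, hdeg,
      Fintype.card_sum, Finset.sum_const, Finset.card_univ, smul_eq_mul, two_mul]
  rw [← hcard]
  have hadj (p : {p : (V ≃ (Fin m × Fin (d + 1)) ⊕ (α ⊕ α)) × (α → Finset α) //
        (cliquesAndBipartite m d p.2).comap p.1 = G}) (i : Fin m) (a : Fin d) :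
      G.Adj (p.1.1.symm (Sum.inl (i, 0))) (p.1.1.symm (Sum.inl (i, a.succ))) := by
    obtain ⟨⟨e, B⟩, rfl⟩ := p
    simp only [SimpleGraph.comap_adj, Equiv.apply_symm_apply]
    exact ⟨rfl, (Fin.succ_ne_zero a).symm⟩
  refine Nat.card_le_card_of_injective
    (fun p => (fun i => ⟨p.1.1.symm (Sum.inl (i, 0)),
      fun a => ⟨p.1.1.symm (Sum.inl (i, a.succ)), hadj p i a⟩⟩,
      fun x => p.1.1.symm (Sum.inr x))) ?_
  intro p q h
  have hsymm : p.1.1.symm = q.1.1.symm := by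
    have h1 := congrArg Prod.fst h
    have h2 := congrArg Prod.snd h
    ext (⟨i, a⟩ | x)
    · have h3 := congrFun h1 i
      refine Fin.cases ?_ (fun a => ?_) a
      · exact congrArg Sigma.fst h3
      · exact congrArg (fun s : Σ v : V, (Fin d → G.neighborSet v) => ((s.2 a : V))) h3
    · exact congrFun h2 x
  obtain ⟨⟨e, B⟩, hp⟩ := p
  obtain ⟨⟨e', C⟩, hq⟩ := q
  obtain rfl : e = e' := Equiv.symm_bijective.injective hsymm
  obtain rfl : B = C := by
    funext x
    ext y
    have := congrArg (fun H : SimpleGraph V =>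
      H.Adj (e.symm (Sum.inr (Sum.inl x))) (e.symm (Sum.inr (Sum.inr y)))) (hp.trans hq.symm)
    simp only [SimpleGraph.comap_adj, Equiv.apply_symm_apply] at this
    exact iff_of_eq this
  rfl

theorem factorial_mul_card_regularRelations_le (n d m h : ℕ) (c : ℝ)
    (hn : m * (d + 1) + 2 * h = n) (hm : c * n ≤ m * (d + 1)) :
    n.factorial * (regularRelations (Fin h) d).card ≤
      Nat.card (Gdc n d c) * ((n * d ^ d) ^ m * n ^ (2 * h)) := by
  classical
  let X := (Fin m × Fin (d + 1)) ⊕ (Fin h ⊕ Fin h)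
  have hX : Fintype.card (Fin n) = Fintype.card X := by
    simp [X]; omega
  let f (p : (Fin n ≃ X) × (Fin h → Finset (Fin h))) : SimpleGraph (Fin n) :=
    (cliquesAndBipartite m d p.2).comap p.1
  have hmaps : ∀ p ∈ (Finset.univ : Finset (Fin n ≃ X)) ×ˢ regularRelations (Fin h) d,
      f p ∈ (Gdc n d c).toFinset := by
    rintro ⟨e, B⟩ hp
    have hB := (Finset.mem_product.1 hp).2
    rw [Set.mem_toFinset]
    refine ⟨(isDRegular_cliquesAndBipartite m d hB).comap_equiv e, ?_⟩
    have h1 : ((m * (d + 1).choose 3 : ℕ) : ℝ) ≤ (cliqueCount (f (e, B)) 3 : ℝ) :=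
      Nat.cast_le.2 (mul_choose_le_cliqueCount m d 3 (by norm_num) B e)
    refine le_trans ?_ h1
    have h2 : ((d + 1).choose 3 : ℝ) * 3 = (d + 1) * d.choose 2 := by
      exact_mod_cast (Nat.add_one_mul_choose_eq d 2).symm
    have h3 := mul_le_mul_of_nonneg_right hm (Nat.cast_nonneg (α := ℝ) (d.choose 2))
    push_cast
    have h4 : (m : ℝ) * ((d + 1).choose 3 * 3) = m * ((d + 1) * d.choose 2) := by rw [h2]
    linarith
  have hfiber : ∀ G ∈ (Gdc n d c).toFinset,
      (((Finset.univ : Finset (Fin n ≃ X)) ×ˢ regularRelations (Fin h) d).filter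
        fun p => f p = G).card ≤ (n * d ^ d) ^ m * n ^ (2 * h) := by
    intro G hG
    rw [Set.mem_toFinset] at hG
    have h1 := card_representations_le (α := Fin h) m d hG.1
    rw [Nat.card_eq_fintype_card, Fintype.card_subtype, Fintype.card_fin, Fintype.card_fin] at h1
    refine le_trans (Finset.card_le_card fun p hp => ?_) h1
    simpa [f] using (Finset.mem_filter.1 hp).2
  have := Finset.card_le_mul_card_image_of_maps_to hmaps _ hfiber
  rw [Finset.card_product, Finset.card_univ, Fintype.card_equiv (Fintype.equivOfCardEq hX),
    Fintype.card_fin, Set.toFinset_card, ← Nat.card_eq_fintype_card] at this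
  rwa [mul_comm (Nat.card _)]

theorem mul_log_sub_le_log_factorial (k : ℕ) :
    (k : ℝ) * Real.log k - k ≤ Real.log k.factorial := by
  rcases Nat.eq_zero_or_pos k with rfl | hk
  · simp
  have hk' : (0 : ℝ) < k := Nat.cast_pos.2 hk
  have hfac : (0 : ℝ) < k.factorial := Nat.cast_pos.2 k.factorial_pos
  have h := Real.log_le_log (by positivity) (Real.pow_div_factorial_le_exp (k : ℝ) hk'.le k)
  rw [Real.log_exp, Real.log_div (by positivity) hfac.ne', Real.log_pow] at h
  linarith

/-- The logarithmic lower bound for the number of regular graphs containing `m` cliques. -/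
theorem le_log_card_Gdc (n d m h : ℕ) (c : ℝ) (hd : 0 < d) (hh : 4 * d ≤ h)
    (hn : m * (d + 1) + 2 * h = n) (hm : c * n ≤ m * (d + 1)) :
    (m * d : ℝ) * (Real.log n - Real.log d) + (d * h : ℝ) * (Real.log h - Real.log d) - n
      - (d * h : ℝ) * (1 + Real.log 3) ≤ Real.log (Nat.card (Gdc n d c)) := by
  have h1 := factorial_mul_card_regularRelations_le n d m h c hn hm
  have h2 := factorial_pow_le_card_regularRelations (α := Fin h) d d le_rfl (by simpa using hh)
  rw [Fintype.card_fin] at h2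
  set R := (regularRelations (Fin h) d).card
  set N := Nat.card (Gdc n d c)
  have hR : 0 < R := by
    refine Nat.pos_of_ne_zero fun h0 => ?_
    rw [h0, zero_mul] at h2
    exact absurd h2 (not_le.2 (pow_pos h.factorial_pos d))
  have hN : 0 < N := by
    refine Nat.pos_of_ne_zero fun h0 => ?_
    rw [h0, zero_mul] at h1
    exact absurd h1 (not_le.2 (Nat.mul_pos n.factorial_pos hR))
  have hn0 : 0 < n := by omega
  have hR' : (R : ℝ) ≠ 0 := by positivity
  have hN' : (N : ℝ) ≠ 0 := by positivity
  have hn' : (n : ℝ) ≠ 0 := by positivity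
  have hd' : (d : ℝ) ≠ 0 := by positivity
  have hfn : (n.factorial : ℝ) ≠ 0 := by positivity
  have hfh : (h.factorial : ℝ) ≠ 0 := by positivity
  have l1 : Real.log n.factorial + Real.log R ≤
      Real.log N + (m * (Real.log n + d * Real.log d) + 2 * h * Real.log n) := by
    have h3 : (n.factorial : ℝ) * R ≤ N * ((n * d ^ d) ^ m * n ^ (2 * h)) := by exact_mod_cast h1
    have h4 := Real.log_le_log (by positivity) h3
    rw [Real.log_mul hfn hR', Real.log_mul hN' (by positivity),
      Real.log_mul (by positivity) (by positivity), Real.log_pow, Real.log_pow,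
      Real.log_mul hn' (by positivity), Real.log_pow] at h4
    push_cast at h4
    exact h4
  have l2 : d * Real.log h.factorial ≤
      Real.log R + d * (h * Real.log d + h * Real.log 3) := by
    have h3 : (h.factorial : ℝ) ^ d ≤ R * (d ^ h * 3 ^ h) ^ d := by exact_mod_cast h2
    have h4 := Real.log_le_log (by positivity) h3
    rwa [Real.log_mul hR' (by positivity), Real.log_pow, Real.log_pow,
      Real.log_mul (by positivity) (by positivity), Real.log_pow, Real.log_pow] at h4
  have l3 := mul_log_sub_le_log_factorial n
  have l4 := mul_le_mul_of_nonneg_left (mul_log_sub_le_log_factorial h) (Nat.cast_nonneg (α := ℝ) d)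
  have l5 : (n : ℝ) * Real.log n = (m * (d + 1) + 2 * h) * Real.log n := by
    rw [← hn]; push_cast; ring
  linarith

/-- The number of cliques can be rounded so that an even number of vertices remains. -/
theorem exists_clique_number (n d : ℕ) (c : ℝ) (hc : 0 ≤ c) (heven : Even (n * d))
    (hsmall : c * n + 2 * (d + 1) ≤ n) :
    ∃ m h : ℕ, m * (d + 1) + 2 * h = n ∧ c * n ≤ m * (d + 1) ∧
      (m : ℝ) * (d + 1) ≤ c * n + 2 * (d + 1) := by
  have hd : (0 : ℝ) < d + 1 := by positivity
  set k := ⌈c * n / (d + 1)⌉₊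
  have hk1 : c * n ≤ k * (d + 1) := (div_le_iff₀ hd).1 (Nat.le_ceil _)
  have hk2 : (k : ℝ) * (d + 1) ≤ c * n + (d + 1) := by
    have h1 : (k : ℝ) < c * n / (d + 1) + 1 := Nat.ceil_lt_add_one (by positivity)
    have h2 := mul_le_mul_of_nonneg_right h1.le hd.le
    rwa [add_mul, div_mul_cancel₀ _ hd.ne', one_mul] at h2
  obtain ⟨m, hpar, hm1, hm2⟩ : ∃ m : ℕ, Even (n + m * (d + 1)) ∧ c * n ≤ m * (d + 1) ∧
      (m : ℝ) * (d + 1) ≤ c * n + 2 * (d + 1) := by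
    by_cases hk : Even (n + k * (d + 1))
    · exact ⟨k, hk, hk1, by linarith⟩
    · refine ⟨k + 1, ?_, by push_cast; linarith, by push_cast; linarith⟩
      simp only [Nat.even_add, Nat.even_mul, Nat.even_add_one] at hk heven ⊢
      tauto
  have hle : m * (d + 1) ≤ n := by exact_mod_cast hm2.trans hsmall
  obtain ⟨h, hh⟩ : Even (n - m * (d + 1)) := by
    rw [Nat.even_sub hle]
    exact Nat.even_add.1 hpar
  exact ⟨m, h, by omega, hm1, hm2⟩

/-- Lower bound: for fixed `c ∈ (0,1)` there is `C > 0` such that for all `n, d` with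
`3 ≤ d`, `n*d` even and `d + 2 ≤ (1-c)*n`,
`log |G_{d,c}(n)| ≥ (1 - c(d-1)/(d+1)) (dn/2) log(n/(d+1)) - C d n`. -/
theorem counting_lower_bound (c : ℝ) (hc0 : 0 < c) (hc1 : c < 1) :
    ∃ C : ℝ, 0 < C ∧ ∀ n d : ℕ, 3 ≤ d → Even (n * d) → (d : ℝ) + 2 ≤ (1 - c) * n →
      (1 - c * ((d : ℝ) - 1) / ((d : ℝ) + 1)) * ((d : ℝ) * n / 2) *
          Real.log ((n : ℝ) / ((d : ℝ) + 1)) - C * d * n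
        ≤ Real.log (Nat.card (Gdc n d c)) := by
  set a := 1 - c with ha
  have ha0 : 0 < a := by linarith
  have hlog4 : 0 ≤ Real.log (4 / a) := Real.log_nonneg (by rw [le_div_iff₀ ha0]; linarith)
  have hlog16 : 0 ≤ Real.log (16 / a) := Real.log_nonneg (by rw [le_div_iff₀ ha0]; linarith)
  have hlog3 : Real.log 3 ≤ 2 := by
    have := Real.log_le_sub_one_of_pos (show (0 : ℝ) < 3 by norm_num)
    linarith
  refine ⟨Real.log (16 / a) + Real.log (4 / a) + 5, by positivity, ?_⟩
  intro n d hd3 heven hdn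
  have hd : (3 : ℝ) ≤ d := by exact_mod_cast hd3
  have hd1 : (0 : ℝ) < (d : ℝ) + 1 := by linarith
  have hn0 : (0 : ℝ) < n := by
    by_contra h
    nlinarith
  have hdn0 : (0 : ℝ) ≤ d * n := by positivity
  have hfrac : c * ((d : ℝ) - 1) / (d + 1) ≤ 1 := by
    rw [div_le_one hd1]
    nlinarith
  have hfrac0 : 0 ≤ c * ((d : ℝ) - 1) / (d + 1) :=
    div_nonneg (mul_nonneg hc0.le (by linarith)) hd1.le
  set q := c * ((d : ℝ) - 1) / (d + 1) with hq
  set L := Real.log ((n : ℝ) / (d + 1)) with hL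
  by_cases hbig : (n : ℝ) / (d + 1) ≤ 16 / a
  · have hLle : L ≤ Real.log (16 / a) := Real.log_le_log (by positivity) hbig
    have h1 : (1 - q) * ((d : ℝ) * n / 2) * L ≤ d * n * Real.log (16 / a) := by
      calc (1 - q) * ((d : ℝ) * n / 2) * L
          ≤ (1 - q) * ((d : ℝ) * n / 2) * Real.log (16 / a) :=
            mul_le_mul_of_nonneg_left hLle
              (mul_nonneg (by linarith) (by positivity))
        _ ≤ d * n * Real.log (16 / a) := by
            refine mul_le_mul_of_nonneg_right ?_ hlog16
            nlinarith
    have h2 : 0 ≤ Real.log (Nat.card (Gdc n d c)) := Real.log_natCast_nonneg _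
    have h3 : 0 ≤ d * n * Real.log (4 / a) := mul_nonneg hdn0 hlog4
    linarith
  have hbig' : 16 * ((d : ℝ) + 1) ≤ a * n := by
    rw [not_le, div_lt_div_iff₀ ha0 hd1] at hbig
    linarith
  obtain ⟨m, h, hmh, hm1, hm2⟩ := exists_clique_number n d c hc0.le heven (by
    have : a * n = n - c * n := by rw [ha]; ring
    linarith)
  have hmh' : (m : ℝ) * (d + 1) + 2 * h = n := by exact_mod_cast hmh
  have hh : a * n / 4 ≤ h := by
    have : a * n = n - c * n := by rw [ha]; ring
    linarith
  have h4d : 4 * d ≤ h := by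
    have : (4 * d : ℝ) ≤ h := by linarith
    exact_mod_cast this
  have hmain := le_log_card_Gdc n d m h c (by omega) h4d hmh hm1
  have hLeq : L = Real.log n - Real.log ((d : ℝ) + 1) := Real.log_div hn0.ne' hd1.ne'
  have hlogd : Real.log d ≤ Real.log ((d : ℝ) + 1) := Real.log_le_log (by linarith) (by linarith)
  have hlogh : Real.log n - Real.log (4 / a) ≤ Real.log h := by
    rw [← Real.log_div hn0.ne' (by positivity)]
    refine Real.log_le_log (by positivity) (le_trans (le_of_eq ?_) hh)
    field_simp
  have hL0 : 0 ≤ L := Real.log_nonneg (by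
    rw [le_div_iff₀ hd1]
    nlinarith)
  have hLn : ((d : ℝ) + 1) * L ≤ n := by
    have h1 : L ≤ (n : ℝ) / (d + 1) := (Real.log_le_sub_one_of_pos (by positivity)).trans (by simp)
    have h2 := mul_le_mul_of_nonneg_left h1 hd1.le
    rwa [mul_div_cancel₀ _ hd1.ne'] at h2
  have hm0 : (0 : ℝ) ≤ m := m.cast_nonneg
  have hh0 : (0 : ℝ) ≤ h := h.cast_nonneg
  have hd0 : (0 : ℝ) ≤ d := d.cast_nonneg
  have e1 : (m * d : ℝ) * L ≤ (m * d : ℝ) * (Real.log n - Real.log d) :=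
    mul_le_mul_of_nonneg_left (by linarith) (by positivity)
  have e2 : (d * h : ℝ) * (L - Real.log (4 / a)) ≤ (d * h : ℝ) * (Real.log h - Real.log d) :=
    mul_le_mul_of_nonneg_left (by linarith) (by positivity)
  have hhn : (d * h : ℝ) ≤ d * n :=
    mul_le_mul_of_nonneg_left (by nlinarith [mul_nonneg hm0 hd1.le]) hd0
  have e3 : (d * h : ℝ) * (1 + Real.log 3 + Real.log (4 / a)) ≤
      d * n * (3 + Real.log (4 / a)) :=
    mul_le_mul hhn (by linarith) (by positivity) hdn0
  have e4 : (n : ℝ) ≤ d * n := by nlinarith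
  have hmq : (m : ℝ) * (d - 1) ≤ q * n + 2 * (d - 1) := by
    have h1 : (m : ℝ) ≤ (c * n + 2 * (d + 1)) / (d + 1) := (le_div_iff₀ hd1).2 hm2
    refine (mul_le_mul_of_nonneg_right h1 (by linarith)).trans (le_of_eq ?_)
    rw [hq]
    field_simp
  have e5 : (1 - q) * ((d : ℝ) * n / 2) - d * (d + 1) ≤ m * d + d * h := by
    have h1 : (h : ℝ) = (n - m * (d + 1)) / 2 := by linarith
    have h2 := mul_le_mul_of_nonneg_left hmq hd0
    rw [h1]
    clear_value q
    linarith
  have e6 := mul_le_mul_of_nonneg_right e5 hL0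
  have e7 := mul_le_mul_of_nonneg_left hLn hd0
  have e8 : 0 ≤ d * n * Real.log (16 / a) := mul_nonneg hdn0 hlog16
  linarith
end

section
/- For every fixed c ∈ (0,1) there exists a constant C > 0 such that for all n and d with 3 ≤ d and d² ≤ n, the cardinality of G_{d,c}(n) satisfies log|G_{d,c}(n)| ≤ (1 - c·(d-1)/(d+1))·(d·n/2)·log(n/(d+1)) + c·(d·n/2)·log d + C·d·n. -/
section

open Finset

/-- If the total weight of the possible values at each position is at most `B`, whatever the
preceding values are, then the total weight of the sequences of length `m` is at most `B ^ m`. -/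
theorem sum_prod_history_le {α : Type*} [Fintype α] (W : (k : ℕ) → (Fin k → α) → α → ℝ) (B : ℝ)
    (hW : ∀ k h a, 0 ≤ W k h a) (hB : ∀ k h, ∑ a, W k h a ≤ B) (m : ℕ) :
    ∑ S : Fin m → α, ∏ i : Fin m, W i (fun j => S (Fin.castLE i.is_lt.le j)) (S i) ≤ B ^ m := by
  induction m with
  | zero => simp
  | succ m ih =>
    rw [← (Fin.snocEquiv (fun _ => α)).sum_comp, Fintype.sum_prod_type_right, pow_succ]
    have hB0 : 0 ≤ B := (sum_nonneg fun a _ => hW 0 Fin.elim0 a).trans (hB 0 Fin.elim0)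
    calc _ = ∑ S : Fin m → α, (∏ i : Fin m, W i (fun j => S (Fin.castLE i.is_lt.le j)) (S i)) *
              ∑ a, W m S a := by
            refine sum_congr rfl fun S _ => ?_
            rw [mul_sum]
            refine sum_congr rfl fun a _ => ?_
            rw [Fin.prod_univ_castSucc]
            congr 1
            · refine prod_congr rfl fun i _ => ?_
              simp only [Fin.snocEquiv_apply, Fin.snoc_castSucc, Fin.val_castSucc]
              congr 1
              ext j
              exact Fin.snoc_castSucc (α := fun _ => α) (i := Fin.castLE i.is_lt.le j) ..
            · simp only [Fin.snocEquiv_apply, Fin.snoc_last, Fin.val_last]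
              congr 1
              ext j
              exact Fin.snoc_castSucc (α := fun _ => α) (i := j) ..
      _ ≤ ∑ S : Fin m → α, (∏ i : Fin m, W i (fun j => S (Fin.castLE i.is_lt.le j)) (S i)) * B :=
            sum_le_sum fun S _ =>
              mul_le_mul_of_nonneg_left (hB _ _) (prod_nonneg fun _ _ => hW _ _ _)
      _ ≤ _ := by
            rw [← sum_mul]
            exact mul_le_mul_of_nonneg_right ih hB0

theorem card_perm_min_mul_card {V : Type*} [Fintype V] [LinearOrder V] (Q : Finset V) {v : V}
    (hv : v ∈ Q) :
    #{σ : Equiv.Perm V | ∀ x ∈ Q, σ v ≤ σ x} * #Q = (Fintype.card V).factorial := by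
  have heq : ∀ w ∈ Q, #{σ : Equiv.Perm V | ∀ x ∈ Q, σ w ≤ σ x} =
      #{σ : Equiv.Perm V | ∀ x ∈ Q, σ v ≤ σ x} := by
    intro w hw
    have hQ : ∀ x ∈ Q, Equiv.swap v w x ∈ Q := by
      intro x hx
      rw [Equiv.swap_apply_def]
      split_ifs <;> assumption
    refine card_bij' (fun σ _ => σ * Equiv.swap v w) (fun σ _ => σ * Equiv.swap v w) ?_ ?_ ?_ ?_
    · simp only [mem_filter, mem_univ, true_and, Equiv.Perm.mul_apply, Equiv.swap_apply_left]
      exact fun σ h x hx => h _ (hQ x hx)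
    · simp only [mem_filter, mem_univ, true_and, Equiv.Perm.mul_apply, Equiv.swap_apply_right]
      exact fun σ h x hx => h _ (hQ x hx)
    · intro σ _; simp [mul_assoc]
    · intro σ _; simp [mul_assoc]
  rw [← Fintype.card_perm, ← card_univ, mul_comm, ← smul_eq_mul, ← sum_const,
    ← sum_congr rfl heq, ← card_biUnion]
  · congr 1
    ext σ
    simp only [mem_biUnion, mem_filter, mem_univ, true_and, iff_true]
    exact exists_min_image Q σ ⟨v, hv⟩
  · intro a ha b hb hab
    simp only [Function.onFun, Finset.disjoint_left, mem_filter, mem_univ, true_and]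
    exact fun σ h1 h2 => hab (σ.injective (le_antisymm (h1 b hb) (h2 a ha)))

open scoped Classical in
theorem IsDRegular.card_filter_adj {V : Type*} [Fintype V] {G : SimpleGraph V} {d : ℕ}
    (hG : IsDRegular G d) (v : V) : #{w | G.Adj v w} = d := by
  rw [← hG v, ← Set.ncard_coe_finset]
  congr 1
  ext w
  simp

open scoped Classical in
theorem six_mul_cliqueCount_three_le {V : Type*} [Fintype V] (G : SimpleGraph V) :
    6 * cliqueCount G 3 ≤
      ∑ p : V × V, if G.Adj p.1 p.2 then #{v | G.Adj v p.1 ∧ G.Adj v p.2} else 0 := by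
  have hT : cliqueCount G 3 = #{t : Finset V | G.IsNClique 3 t} := by
    rw [cliqueCount, Nat.card_eq_fintype_card, Fintype.card_subtype]
  have hR : (∑ p : V × V, if G.Adj p.1 p.2 then #{v | G.Adj v p.1 ∧ G.Adj v p.2} else 0) =
      #{q : (V × V) × V | G.Adj q.1.1 q.1.2 ∧ G.Adj q.2 q.1.1 ∧ G.Adj q.2 q.1.2} := by
    symm
    rw [card_filter, Fintype.sum_prod_type]
    refine sum_congr rfl fun p _ => ?_
    split_ifs with h
    · simp [h]
    · simp [h]
  rw [hT, hR]
  refine mul_card_image_le_card_of_maps_to (f := fun q => ({q.1.1, q.1.2, q.2} : Finset V)) ?_ 6 ?_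
  · rintro ⟨⟨a, b⟩, c⟩ h
    simp only [mem_filter, mem_univ, true_and] at h ⊢
    exact SimpleGraph.is3Clique_triple_iff.2 ⟨h.1, h.2.1.symm, h.2.2.symm⟩
  · intro t ht
    obtain ⟨a, b, c, hab, hac, hbc, rfl⟩ := SimpleGraph.is3Clique_iff.1 (mem_filter.1 ht).2
    have h6 : #({((a, b), c), ((a, c), b), ((b, a), c), ((b, c), a), ((c, a), b), ((c, b), a)} :
        Finset ((V × V) × V)) = 6 := by
      simp [card_insert_of_notMem, hab.ne, hac.ne, hbc.ne, hab.ne', hac.ne', hbc.ne']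
    rw [← h6]
    refine card_le_card fun q hq => ?_
    simp only [mem_insert, mem_singleton] at hq
    simp only [mem_filter, mem_univ, true_and]
    rcases hq with rfl | rfl | rfl | rfl | rfl | rfl <;>
      refine ⟨by simp [hab, hac, hbc, hab.symm, hac.symm, hbc.symm], ?_⟩ <;>
      ext x <;> simp only [mem_insert, mem_singleton] <;> tauto

open scoped Classical in
theorem card_common_mul_factorial_le {V : Type*} [Fintype V] [LinearOrder V] {G : SimpleGraph V}
    {d : ℕ} (hG : IsDRegular G d) {a b : V} (hab : G.Adj a b) :
    #{v | G.Adj v a ∧ G.Adj v b} * (Fintype.card V).factorial ≤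
      (d + 1) * #{σ : Equiv.Perm V | ∃ v, (σ v < σ a ∧ σ v < σ b) ∧ G.Adj v a ∧ G.Adj v b} := by
  set C : Finset V := {v | G.Adj v a ∧ G.Adj v b} with hC
  set Q : Finset V := insert a (insert b C) with hQ
  have hCmem (v : V) : v ∈ C ↔ G.Adj v a ∧ G.Adj v b := by simp [hC]
  have haC : a ∉ C := by simp [hCmem]
  have hbC : b ∉ C := by simp [hCmem]
  have hQcard : #Q = #C + 2 := by
    rw [hQ, card_insert_of_notMem (by simp [hab.ne, haC]), card_insert_of_notMem hbC]
  have hQd : #Q ≤ d + 1 := by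
    rw [hQcard, ← hG.card_filter_adj a]
    have : insert b C ⊆ ({w | G.Adj a w} : Finset V) := by
      intro x hx
      rcases mem_insert.1 hx with rfl | hx
      · simpa using hab
      · simpa using ((hCmem x).1 hx).1.symm
    have := card_le_card this
    rw [card_insert_of_notMem hbC] at this
    omega
  have hsum : ∑ v ∈ C, #{σ : Equiv.Perm V | ∀ x ∈ Q, σ v ≤ σ x} ≤
      #{σ : Equiv.Perm V | ∃ v, (σ v < σ a ∧ σ v < σ b) ∧ G.Adj v a ∧ G.Adj v b} := by
    rw [← card_biUnion]
    · refine card_le_card fun σ hσ => ?_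
      simp only [mem_biUnion, mem_filter, mem_univ, true_and] at hσ ⊢
      obtain ⟨v, hv, hmin⟩ := hσ
      have hv' := (hCmem v).1 hv
      exact ⟨v, ⟨(hmin a (by simp [hQ])).lt_of_ne (σ.injective.ne hv'.1.ne),
        (hmin b (by simp [hQ])).lt_of_ne (σ.injective.ne hv'.2.ne)⟩, hv'⟩
    · intro v hv w hw hvw
      have hv' : v ∈ Q := mem_insert_of_mem (mem_insert_of_mem hv)
      have hw' : w ∈ Q := mem_insert_of_mem (mem_insert_of_mem hw)
      simp only [Function.onFun, Finset.disjoint_left, mem_filter, mem_univ, true_and]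
      exact fun σ h1 h2 => hvw (σ.injective (le_antisymm (h1 w hw') (h2 v hv')))
  calc #C * (Fintype.card V).factorial
      = ∑ v ∈ C, #Q * #{σ : Equiv.Perm V | ∀ x ∈ Q, σ v ≤ σ x} := by
        rw [← smul_eq_mul, ← sum_const]
        refine sum_congr rfl fun v hv => ?_
        rw [← card_perm_min_mul_card Q (mem_insert_of_mem (mem_insert_of_mem hv)), mul_comm]
    _ = #Q * ∑ v ∈ C, #{σ : Equiv.Perm V | ∀ x ∈ Q, σ v ≤ σ x} := by rw [mul_sum]
    _ ≤ _ := Nat.mul_le_mul hQd hsum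

open scoped Classical in
/-- The pairs `p.1 < p.2` of adjacent vertices with a common neighbour preceding both. -/
noncomputable def closedPairs {V : Type*} [Fintype V] [LinearOrder V] (G : SimpleGraph V) :
    Finset (V × V) :=
  {p | p.1 < p.2 ∧ G.Adj p.1 p.2 ∧ ∃ v, (v < p.1 ∧ v < p.2) ∧ G.Adj v p.1 ∧ G.Adj v p.2}

open scoped Classical in
theorem card_closedPairs_comap {V : Type*} [Fintype V] [LinearOrder V] (G : SimpleGraph V)
    (σ : Equiv.Perm V) :
    #(closedPairs (G.comap σ.symm)) = #{p : V × V | σ p.1 < σ p.2 ∧ G.Adj p.1 p.2 ∧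
      ∃ v, (σ v < σ p.1 ∧ σ v < σ p.2) ∧ G.Adj v p.1 ∧ G.Adj v p.2} := by
  symm
  refine card_equiv (Equiv.prodCongr σ σ) fun p => ?_
  simp only [closedPairs, mem_filter, mem_univ, true_and, Equiv.prodCongr_apply, Prod.map_fst,
    Prod.map_snd, SimpleGraph.comap_adj, Equiv.symm_apply_apply]
  refine and_congr_right fun _ => and_congr_right fun _ => σ.exists_congr fun v => ?_
  rw [Equiv.symm_apply_apply]

open scoped Classical in
theorem six_mul_cliqueCount_mul_factorial_le {V : Type*} [Fintype V] [LinearOrder V]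
    {G : SimpleGraph V} {d : ℕ} (hG : IsDRegular G d) :
    6 * cliqueCount G 3 * (Fintype.card V).factorial ≤
      (d + 1) * (2 * ∑ σ : Equiv.Perm V, #(closedPairs (G.comap σ.symm))) := by
  set P : Equiv.Perm V → V × V → Prop := fun σ p =>
    ∃ v, (σ v < σ p.1 ∧ σ v < σ p.2) ∧ G.Adj v p.1 ∧ G.Adj v p.2
  have hsplit (σ : Equiv.Perm V) :
      #{p : V × V | G.Adj p.1 p.2 ∧ P σ p} = 2 * #(closedPairs (G.comap σ.symm)) := by
    have hswap : #{p : V × V | σ p.2 < σ p.1 ∧ G.Adj p.1 p.2 ∧ P σ p} =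
        #{p : V × V | σ p.1 < σ p.2 ∧ G.Adj p.1 p.2 ∧ P σ p} := by
      refine card_equiv (Equiv.prodComm V V) fun p => ?_
      simp only [mem_filter, mem_univ, true_and, Equiv.prodComm_apply, Prod.fst_swap,
        Prod.snd_swap, P, G.adj_comm p.2 p.1, and_comm (a := σ _ < σ p.2),
        and_comm (a := G.Adj _ p.2)]
    rw [card_closedPairs_comap, two_mul]
    nth_rewrite 1 [← hswap]
    rw [← card_union_of_disjoint]
    · congr 1
      ext p
      simp only [mem_union, mem_filter, mem_univ, true_and]
      rw [← or_and_right, iff_comm, and_iff_right_of_imp]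
      exact fun h => (σ.injective.ne h.1.ne).lt_or_gt.symm
    · rw [Finset.disjoint_left]
      simp only [mem_filter, mem_univ, true_and]
      exact fun p h1 h2 => lt_asymm h1.1 h2.1
  calc _ ≤ (∑ p : V × V, if G.Adj p.1 p.2 then #{v | G.Adj v p.1 ∧ G.Adj v p.2} else 0) *
            (Fintype.card V).factorial :=
        Nat.mul_le_mul_right _ (six_mul_cliqueCount_three_le G)
    _ ≤ ∑ p : V × V, (d + 1) * #{σ : Equiv.Perm V | G.Adj p.1 p.2 ∧ P σ p} := by
        rw [sum_mul]
        refine sum_le_sum fun p _ => ?_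
        split_ifs with h
        · simpa [h] using card_common_mul_factorial_le hG h
        · simp
    _ = (d + 1) * ∑ σ : Equiv.Perm V, #{p : V × V | G.Adj p.1 p.2 ∧ P σ p} := by
        rw [← mul_sum]
        simp only [card_filter]
        rw [sum_comm]
    _ = _ := by simp only [hsplit, mul_sum]

/-- The vertices having a common in-neighbour with `k`, given the out-neighbourhoods `h` of the
vertices below `k`; replaced by the empty set when there are more than `D` of them. -/
def closers {n : ℕ} (D k : ℕ) (h : Fin k → Finset (Fin n)) : Finset (Fin n) :=
  let A : Finset (Fin n) := {u | ∃ j, u ∈ h j ∧ ∃ x ∈ h j, (x : ℕ) = k}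
  if #A ≤ D then A else ∅

theorem card_closers_le {n : ℕ} (D k : ℕ) (h : Fin k → Finset (Fin n)) : #(closers D k h) ≤ D := by
  unfold closers
  dsimp only
  split_ifs with hA
  · exact hA
  · simp

open scoped Classical in
/-- The neighbours of `i` above `i`. -/
noncomputable def forwardNeighbors {n : ℕ} (G : SimpleGraph (Fin n)) (i : Fin n) :
    Finset (Fin n) :=
  {j | i < j ∧ G.Adj i j}

theorem forwardNeighbors_injective {n : ℕ} :
    Function.Injective (forwardNeighbors : SimpleGraph (Fin n) → Fin n → Finset (Fin n)) := by
  intro G H h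
  have key (i j : Fin n) (hij : i < j) : G.Adj i j ↔ H.Adj i j := by
    have := congrArg (j ∈ ·) (congrFun h i)
    simpa [forwardNeighbors, hij] using this
  ext i j
  rcases lt_trichotomy i j with hij | rfl | hij
  · exact key i j hij
  · simp
  · rw [G.adj_comm, H.adj_comm]
    exact key j i hij

open scoped Classical in
theorem IsDRegular.two_mul_sum_card_forwardNeighbors {n d : ℕ} {G : SimpleGraph (Fin n)}
    (hG : IsDRegular G d) : 2 * ∑ i, #(forwardNeighbors G i) = n * d := by
  have hback : ∑ i, #{j | j < i ∧ G.Adj i j} = ∑ i, #(forwardNeighbors G i) := by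
    simp only [forwardNeighbors, card_filter]
    rw [sum_comm]
    simp only [G.adj_comm]
  have hsplit (i : Fin n) : #{j | j < i ∧ G.Adj i j} + #(forwardNeighbors G i) = d := by
    rw [← hG.card_filter_adj i, forwardNeighbors, ← card_union_of_disjoint]
    · congr 1
      ext j
      simp only [mem_union, mem_filter, mem_univ, true_and]
      rw [← or_and_right, and_iff_right_of_imp]
      exact fun h => h.ne.lt_or_gt.symm
    · rw [Finset.disjoint_left]
      simp only [mem_filter, mem_univ, true_and]
      exact fun j h1 h2 => lt_asymm h1.1 h2.1
  rw [two_mul]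
  nth_rewrite 1 [← hback]
  rw [← sum_add_distrib, sum_congr rfl fun i _ => hsplit i]
  simp

open scoped Classical in
theorem IsDRegular.mem_closers_iff {n d : ℕ} {G : SimpleGraph (Fin n)} (hG : IsDRegular G d)
    (i u : Fin n) :
    u ∈ closers (d ^ 2) i (fun j => forwardNeighbors G (Fin.castLE i.is_lt.le j)) ↔
      ∃ v, (v < i ∧ v < u) ∧ G.Adj v i ∧ G.Adj v u := by
  set A : Finset (Fin n) := {u | ∃ j : Fin i, u ∈ forwardNeighbors G (Fin.castLE i.is_lt.le j) ∧
    ∃ x ∈ forwardNeighbors G (Fin.castLE i.is_lt.le j), (x : ℕ) = i} with hA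
  have hmem (u : Fin n) : u ∈ A ↔ ∃ v, (v < i ∧ v < u) ∧ G.Adj v i ∧ G.Adj v u := by
    simp only [hA, forwardNeighbors, mem_filter, mem_univ, true_and]
    constructor
    · rintro ⟨j, ⟨h1, h2⟩, x, ⟨h3, h4⟩, hx⟩
      obtain rfl := Fin.ext hx
      exact ⟨_, ⟨h3, h1⟩, h4, h2⟩
    · rintro ⟨v, ⟨h1, h2⟩, h3, h4⟩
      exact ⟨⟨v, h1⟩, ⟨h2, h4⟩, i, ⟨h1, h3⟩, rfl⟩
  have hcard : #A ≤ d ^ 2 := by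
    have hsub : A ⊆ ({v | G.Adj i v} : Finset (Fin n)).biUnion fun v => {u | G.Adj v u} := by
      intro u hu
      obtain ⟨v, -, h3, h4⟩ := (hmem u).1 hu
      simp only [mem_biUnion, mem_filter, mem_univ, true_and]
      exact ⟨v, h3.symm, h4⟩
    refine (card_le_card hsub).trans ((card_biUnion_le_card_mul _ _ d fun v _ =>
      (hG.card_filter_adj v).le).trans ?_)
    rw [hG.card_filter_adj, sq]
  rw [← hmem, closers, if_pos]
  convert hcard

open scoped Classical in
theorem IsDRegular.prod_weight {n d : ℕ} {G : SimpleGraph (Fin n)} (hG : IsDRegular G d)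
    (s l : ℝ) :
    ∏ i : Fin n, ∏ u ∈ forwardNeighbors G i, (s * if u ∈ closers (d ^ 2) i
        (fun j => forwardNeighbors G (Fin.castLE i.is_lt.le j)) then l else 1) =
      s ^ (∑ i, #(forwardNeighbors G i)) * l ^ #(closedPairs G) := by
  simp only [prod_mul_distrib, prod_const, prod_pow_eq_pow_sum, prod_ite, one_pow, mul_one]
  congr 2
  simp only [hG.mem_closers_iff, closedPairs]
  rw [card_filter, Fintype.sum_prod_type]
  refine sum_congr rfl fun i _ => ?_
  rw [forwardNeighbors, filter_filter, card_filter]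
  simp only [and_assoc]

/-- A bound for the total weight of a family of `d`-regular graphs, where each edge contributes a
factor `s` and each closed pair a further factor `l`. -/
theorem sum_weight_le {n d : ℕ} (Γ : Finset (SimpleGraph (Fin n)))
    (hΓ : ∀ G ∈ Γ, IsDRegular G d) {s l : ℝ} (hs : 0 ≤ s) (hl : 0 ≤ l) :
    ∑ G ∈ Γ, s ^ (∑ i, #(forwardNeighbors G i)) * l ^ #(closedPairs G) ≤
      Real.exp (s * (n + l * d ^ 2)) ^ n := by
  classical
  set W : (k : ℕ) → (Fin k → Finset (Fin n)) → Finset (Fin n) → ℝ := fun k h T =>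
    ∏ u ∈ T, (s * if u ∈ closers (d ^ 2) k h then l else 1)
  have hw (k : ℕ) (h : Fin k → Finset (Fin n)) (u : Fin n) :
      0 ≤ s * if u ∈ closers (d ^ 2) k h then l else 1 := by
    split_ifs <;> positivity
  have hW : ∀ k h T, 0 ≤ W k h T := fun k h T => prod_nonneg fun u _ => hw k h u
  have hB : ∀ k h, ∑ T, W k h T ≤ Real.exp (s * (n + l * d ^ 2)) := by
    intro k h
    rw [← powerset_univ, ← prod_one_add]
    refine (Real.prod_one_add_le_exp_sum _ (hw k h)).trans (Real.exp_le_exp.2 ?_)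
    rw [← mul_sum]
    refine mul_le_mul_of_nonneg_left ?_ hs
    rw [sum_ite, sum_const, sum_const, nsmul_eq_mul, nsmul_eq_mul, mul_one, add_comm]
    refine add_le_add ?_ ?_
    · exact_mod_cast (card_le_univ _).trans (Fintype.card_fin n).le
    · rw [mul_comm]
      refine mul_le_mul_of_nonneg_left ?_ hl
      rw [filter_mem_eq_inter, univ_inter]
      exact_mod_cast card_closers_le (d ^ 2) k h
  refine le_trans ?_ (sum_prod_history_le W _ hW hB n)
  rw [← sum_congr rfl fun G hG => (hΓ G hG).prod_weight s l]
  rw [← sum_image (f := fun S : Fin n → Finset (Fin n) =>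
    ∏ i : Fin n, W i (fun j => S (Fin.castLE i.is_lt.le j)) (S i))
    (forwardNeighbors_injective.injOn)]
  exact sum_le_sum_of_subset_of_nonneg (subset_univ _)
    fun S _ _ => prod_nonneg fun i _ => hW _ _ _

theorem IsDRegular.comap_perm {V : Type*} {G : SimpleGraph V} {d : ℕ} (hG : IsDRegular G d)
    (σ : Equiv.Perm V) : IsDRegular (G.comap σ.symm) d := by
  intro v
  have : (G.comap σ.symm).neighborSet v = σ '' G.neighborSet (σ.symm v) := by
    rw [σ.image_eq_preimage_symm]
    rfl
  rw [this, Set.ncard_image_of_injective _ σ.injective, hG]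

theorem IsDRegular.factorial_mul_exp_le {V : Type*} [Fintype V] [LinearOrder V]
    {G : SimpleGraph V} {d : ℕ} (hG : IsDRegular G d) {K L : ℝ} (hL : 0 ≤ L)
    (hK : K * (d + 1) ≤ 3 * cliqueCount G 3) :
    (Fintype.card V).factorial * Real.exp (L * K) ≤
      ∑ σ : Equiv.Perm V, Real.exp (L * #(closedPairs (G.comap σ.symm))) := by
  have hmean : (Fintype.card V).factorial * K ≤
      ∑ σ : Equiv.Perm V, (#(closedPairs (G.comap σ.symm)) : ℝ) := by
    have h : (6 * cliqueCount G 3 * (Fintype.card V).factorial : ℝ) ≤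
        (d + 1) * (2 * ∑ σ : Equiv.Perm V, (#(closedPairs (G.comap σ.symm)) : ℝ)) := by
      exact_mod_cast six_mul_cliqueCount_mul_factorial_le hG
    have h' := mul_le_mul_of_nonneg_right hK ((Fintype.card V).factorial.cast_nonneg (α := ℝ))
    refine le_of_mul_le_mul_left ?_ (by positivity : (0 : ℝ) < d + 1)
    linarith
  have htangent (x : ℝ) : Real.exp (L * K) * (1 + L * (x - K)) ≤ Real.exp (L * x) := by
    have : L * x = L * K + L * (x - K) := by ring
    rw [this, Real.exp_add, add_comm]
    exact mul_le_mul_of_nonneg_left (Real.add_one_le_exp _) (Real.exp_pos _).le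
  refine le_trans ?_ (sum_le_sum fun σ _ => htangent _)
  rw [← mul_sum, mul_comm, sum_add_distrib, ← mul_sum, sum_sub_distrib, sum_const, sum_const,
    card_univ, Fintype.card_perm, nsmul_eq_mul, nsmul_eq_mul, mul_one]
  refine mul_le_mul_of_nonneg_left ?_ (Real.exp_pos _).le
  nlinarith [mul_nonneg hL (sub_nonneg.2 hmean)]

open scoped Classical in
theorem card_mul_exp_le_sum_regular {n d : ℕ} {K L : ℝ} (hL : 0 ≤ L)
    (Γ : Finset (SimpleGraph (Fin n))) (hreg : ∀ G ∈ Γ, IsDRegular G d)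
    (hΓ : ∀ G ∈ Γ, K * (d + 1) ≤ 3 * cliqueCount G 3) :
    #Γ * Real.exp (L * K) ≤
      ∑ G : SimpleGraph (Fin n) with IsDRegular G d, Real.exp (L * #(closedPairs G)) := by
  refine le_of_mul_le_mul_left ?_ (by positivity : (0 : ℝ) < n.factorial)
  calc (n.factorial : ℝ) * (#Γ * Real.exp (L * K))
      = ∑ G ∈ Γ, n.factorial * Real.exp (L * K) := by
        rw [sum_const, nsmul_eq_mul]
        ring
    _ ≤ ∑ G ∈ Γ, ∑ σ : Equiv.Perm (Fin n), Real.exp (L * #(closedPairs (G.comap σ.symm))) := by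
        refine sum_le_sum fun G hG => ?_
        simpa using (hreg G hG).factorial_mul_exp_le hL (hΓ G hG)
    _ = ∑ σ : Equiv.Perm (Fin n), ∑ G ∈ Γ, Real.exp (L * #(closedPairs (G.comap σ.symm))) :=
        sum_comm
    _ ≤ ∑ σ : Equiv.Perm (Fin n), ∑ G : SimpleGraph (Fin n) with IsDRegular G d,
          Real.exp (L * #(closedPairs G)) := by
        refine sum_le_sum fun σ _ => ?_
        rw [← sum_image (f := fun G => Real.exp (L * #(closedPairs G)))
          (Function.LeftInverse.injective (g := SimpleGraph.comap σ) fun G => by ext; simp).injOn]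
        refine sum_le_sum_of_subset_of_nonneg ?_ fun _ _ _ => (Real.exp_pos _).le
        intro H hH
        obtain ⟨G, hG, rfl⟩ := mem_image.1 hH
        simpa using (hreg G hG).comap_perm σ
    _ = _ := by
        rw [sum_const, card_univ, Fintype.card_perm, Fintype.card_fin, nsmul_eq_mul]

theorem log_card_le_of_le_cliqueCount {n d : ℕ} (hd : 0 < d) (hn : d ^ 2 ≤ n) {K : ℝ}
    (Γ : Finset (SimpleGraph (Fin n))) (hne : Γ.Nonempty) (hreg : ∀ G ∈ Γ, IsDRegular G d)
    (hΓ : ∀ G ∈ Γ, K * (d + 1) ≤ 3 * cliqueCount G 3) :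
    Real.log #Γ ≤ d * n / 2 * Real.log (n / d) - K * Real.log (n / d ^ 2) + 2 * d * n := by
  classical
  have hd0 : (0 : ℝ) < d := by exact_mod_cast hd
  have hn' : (d : ℝ) ^ 2 ≤ n := by exact_mod_cast hn
  have hn0 : (0 : ℝ) < n := (by positivity : (0 : ℝ) < (d : ℝ) ^ 2).trans_le hn'
  have hl0 : (0 : ℝ) < n / d ^ 2 := by positivity
  have hs0 : (0 : ℝ) < d / n := by positivity
  set L := Real.log (n / d ^ 2) with hL
  have hL0 : 0 ≤ L := Real.log_nonneg ((one_le_div (by positivity)).2 hn')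
  have h1 := card_mul_exp_le_sum_regular hL0 Γ hreg hΓ
  have h2 := sum_weight_le ({G | IsDRegular G d} : Finset (SimpleGraph (Fin n)))
    (fun G hG => (mem_filter.1 hG).2) hs0.le hl0.le
  have hexp : Real.exp (d / n * (n + n / d ^ 2 * d ^ 2)) ^ n = Real.exp (2 * d * n) := by
    rw [← Real.exp_nat_mul]
    congr 1
    field_simp
    ring
  have hterm : ∀ G ∈ ({G | IsDRegular G d} : Finset (SimpleGraph (Fin n))),
      ((d : ℝ) / n) ^ (∑ i, #(forwardNeighbors G i)) * (n / d ^ 2) ^ #(closedPairs G) =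
        Real.exp (-(d * n / 2 * Real.log (n / d))) * Real.exp (L * #(closedPairs G)) := by
    intro G hG
    have he : (2 * ∑ i, #(forwardNeighbors G i) : ℝ) = n * d := by
      exact_mod_cast (mem_filter.1 hG).2.two_mul_sum_card_forwardNeighbors
    congr 1
    · rw [← Real.exp_log hs0, ← Real.exp_nat_mul, ← inv_div, Real.log_inv]
      congr 1
      linear_combination (-Real.log (n / d) / 2) * he
    · rw [hL, mul_comm, Real.exp_nat_mul, Real.exp_log hl0]
  rw [sum_congr rfl hterm, ← mul_sum, hexp] at h2
  have hcard : (0 : ℝ) < #Γ := by exact_mod_cast hne.card_pos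
  have h3 := (mul_le_mul_of_nonneg_left h1
    (Real.exp_pos (-(d * n / 2 * Real.log (n / d)))).le).trans h2
  have h4 := Real.log_le_log (by positivity) h3
  rw [Real.log_mul (Real.exp_pos _).ne' (by positivity), Real.log_mul hcard.ne'
    (Real.exp_pos _).ne', Real.log_exp, Real.log_exp, Real.log_exp] at h4
  linarith

end

/-- Upper bound: for fixed `c ∈ (0,1)` there is `C > 0` such that for all `n, d` with
`3 ≤ d` and `d² ≤ n`,
`log |G_{d,c}(n)| ≤ (1 - c(d-1)/(d+1)) (dn/2) log(n/(d+1)) + c (dn/2) log d + C d n`. -/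
theorem counting_upper_bound (c : ℝ) (hc0 : 0 < c) (hc1 : c < 1) :
    ∃ C : ℝ, 0 < C ∧ ∀ n d : ℕ, 3 ≤ d → d ^ 2 ≤ n →
      Real.log (Nat.card (Gdc n d c))
        ≤ (1 - c * ((d : ℝ) - 1) / ((d : ℝ) + 1)) * ((d : ℝ) * n / 2) *
            Real.log ((n : ℝ) / ((d : ℝ) + 1))
          + c * ((d : ℝ) * n / 2) * Real.log d + C * d * n := by
  refine ⟨3, by norm_num, fun n d hd hn => ?_⟩
  classical
  have hd3 : (3 : ℝ) ≤ d := by exact_mod_cast hd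
  have hn' : (d : ℝ) ^ 2 ≤ n := by exact_mod_cast hn
  have hn0 : (0 : ℝ) < n := by nlinarith
  set l := Real.log ((n : ℝ) / (d + 1)) with hl
  have hl0 : 0 ≤ l := Real.log_nonneg ((one_le_div (by positivity)).2 (by nlinarith))
  have hratio : c * ((d : ℝ) - 1) / (d + 1) ≤ c := by
    rw [div_le_iff₀ (by positivity)]
    nlinarith
  have hlogd : 0 ≤ Real.log d := Real.log_nonneg (by linarith)
  have hdn : 0 ≤ (d : ℝ) * n / 2 := by positivity
  have hcard : Nat.card (Gdc n d c) = (Finset.univ.filter (· ∈ Gdc n d c)).card := by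
    rw [Nat.card_eq_fintype_card, Fintype.card_subtype]
  rw [hcard]
  rcases (Finset.univ.filter (· ∈ Gdc n d c)).eq_empty_or_nonempty with h | h
  · rw [h, Finset.card_empty, Nat.cast_zero, Real.log_zero]
    have : 0 ≤ 1 - c * ((d : ℝ) - 1) / (d + 1) := by linarith
    positivity
  have key := log_card_le_of_le_cliqueCount (K := c * ((d : ℝ) - 1) / (d + 1) * (d * n / 2))
    (by omega) hn _ h (fun G hG => (Finset.mem_filter.1 hG).2.1) (fun G hG => by
      have := (Finset.mem_filter.1 hG).2.2
      rw [Nat.cast_choose_two] at this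
      refine le_trans (le_of_eq ?_) (mul_le_mul_of_nonneg_left this (by norm_num))
      field_simp)
  have h1 : Real.log ((n : ℝ) / d) ≤ l + 1 := by
    have hsplit : (n : ℝ) / d = n / (d + 1) * ((d + 1) / d) := by field_simp
    rw [hsplit, Real.log_mul (by positivity) (by positivity)]
    have hle : ((d : ℝ) + 1) / d ≤ 2 := by
      rw [div_le_iff₀ (by positivity)]
      linarith
    linarith [Real.log_le_sub_one_of_pos (by positivity : 0 < ((d : ℝ) + 1) / d)]
  have h2 : l - Real.log d ≤ Real.log ((n : ℝ) / d ^ 2) := by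
    rw [hl, ← Real.log_div (by positivity) (by positivity)]
    refine Real.log_le_log (by positivity) ?_
    rw [div_div]
    gcongr
    nlinarith
  have hK0 : 0 ≤ c * ((d : ℝ) - 1) / (d + 1) * (d * n / 2) := by
    have : 0 ≤ (d : ℝ) - 1 := by linarith
    positivity
  have e1 := mul_le_mul_of_nonneg_left h1 hdn
  have e2 := mul_le_mul_of_nonneg_left h2 hK0
  have e3 := mul_le_mul_of_nonneg_right (mul_le_mul_of_nonneg_right hratio hdn) hlogd
  nlinarith
end

section
/- Fix d ≥ 3 and c ∈ (0,1). As n → ∞ along integers n with n·d even, the ratio (-log(|G_{d,c}(n)| / |G_d(n)|)) / ((d·n/2)·log(n/(d+1))) converges to c·(d-1)/(d+1). -/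
open Filter

/-- `G_d(n)`: the set of all simple `d`-regular graphs on the labeled vertex set `Fin n`. -/
def Gd (n d : ℕ) : Set (SimpleGraph (Fin n)) := {G | IsDRegular G d}

lemma IsDRegular.degree_eq {V : Type*} [Fintype V] {G : SimpleGraph V} [DecidableRel G.Adj]
    {d : ℕ} (h : IsDRegular G d) (v : V) : G.degree v = d := by
  rw [← h v, ← G.card_neighborFinset_eq_degree, ← Set.ncard_coe_finset,
    SimpleGraph.coe_neighborFinset]

open Finset in
/-- Among the elements of `A`, each is the one placed first by at most a fraction `1 / #A` of all
permutations. -/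
lemma card_mul_card_perm_min_le {V : Type*} [Fintype V] [LinearOrder V]
    (A : Finset V) {u : V} (hu : u ∈ A) :
    #A * #{σ : Equiv.Perm V | ∀ w ∈ A, σ u ≤ σ w} ≤ (Fintype.card V).factorial := by
  have heq : ∀ x ∈ A, #{σ : Equiv.Perm V | ∀ w ∈ A, σ x ≤ σ w} =
      #{σ : Equiv.Perm V | ∀ w ∈ A, σ u ≤ σ w} := by
    intro x hx
    have hswap : ∀ w ∈ A, Equiv.swap u x w ∈ A := by
      intro w hw
      rw [Equiv.swap_apply_def]
      split_ifs <;> assumption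
    refine card_bij' (fun σ _ => σ * Equiv.swap u x) (fun σ _ => σ * Equiv.swap u x) ?_ ?_ ?_ ?_
    · intro σ h
      simp only [mem_filter, mem_univ, true_and, Equiv.Perm.mul_apply, Equiv.swap_apply_left] at h ⊢
      exact fun w hw => h _ (hswap w hw)
    · intro σ h
      simp only [mem_filter, mem_univ, true_and, Equiv.Perm.mul_apply,
        Equiv.swap_apply_right] at h ⊢
      exact fun w hw => h _ (hswap w hw)
    · intro σ _
      simp [mul_assoc]
    · intro σ _
      simp [mul_assoc]
  rw [← smul_eq_mul, ← sum_const, ← sum_congr rfl heq, ← card_biUnion]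
  · rw [← Fintype.card_perm]
    exact card_le_univ _
  · intro x hx y hy hxy
    rw [Function.onFun_apply, disjoint_left]
    intro σ h1 h2
    simp only [mem_filter, mem_univ, true_and] at h1 h2
    exact hxy (σ.injective (le_antisymm (h1 y hy) (h2 x hx)))

section Triangles

open Finset

variable {V : Type*} [Fintype V] (G : SimpleGraph V) [DecidableRel G.Adj]

/-- The common neighbours of two vertices, as a finset. -/
def commonNbrs (u v : V) : Finset V := {w | G.Adj w u ∧ G.Adj w v}

/-- The ordered pairs of adjacent vertices. -/
def adjPairs : Finset (V × V) := {p | G.Adj p.1 p.2}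

lemma six_mul_cliqueCount_le :
    6 * cliqueCount G 3 ≤ ∑ p ∈ adjPairs G, #(commonNbrs G p.1 p.2) := by
  classical
  have h1 : cliqueCount G 3 = #(G.cliqueFinset 3) := by
    rw [cliqueCount, Nat.card_eq_fintype_card, Fintype.card_subtype]
    rfl
  have h2 : ∀ t ∈ G.cliqueFinset 3, #{p ∈ adjPairs G | p.1 ∈ t ∧ p.2 ∈ t} = 6 := by
    intro t ht
    rw [SimpleGraph.mem_cliqueFinset_iff] at ht
    have : ({p ∈ adjPairs G | p.1 ∈ t ∧ p.2 ∈ t} : Finset (V × V)) = t.offDiag := by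
      ext ⟨u, v⟩
      simp only [adjPairs, mem_filter, mem_univ, true_and, mem_offDiag]
      constructor
      · rintro ⟨h, hu, hv⟩
        exact ⟨hu, hv, h.ne⟩
      · rintro ⟨hu, hv, h⟩
        exact ⟨ht.isClique hu hv h, hu, hv⟩
    rw [this, offDiag_card, ht.card_eq]
  have h3 : ∀ p ∈ adjPairs G, #{t ∈ G.cliqueFinset 3 | p.1 ∈ t ∧ p.2 ∈ t} ≤
      #(commonNbrs G p.1 p.2) := by
    rintro ⟨u, v⟩ hp
    have huv : G.Adj u v := by simpa [adjPairs] using hp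
    refine le_trans (card_le_card (t := (commonNbrs G u v).image fun w => {u, v, w}) ?_)
      card_image_le
    intro t ht
    simp only [mem_filter, SimpleGraph.mem_cliqueFinset_iff] at ht
    obtain ⟨ht, hu, hv⟩ := ht
    have hsub : ({u, v} : Finset V) ⊆ t := by
      intro x hx
      simp only [mem_insert, mem_singleton] at hx
      rcases hx with rfl | rfl <;> assumption
    have hc : #(t \ {u, v}) = 1 := by
      rw [card_sdiff_of_subset hsub, ht.card_eq, card_pair huv.ne]
    obtain ⟨w, hw⟩ := card_eq_one.1 hc
    have hwm : w ∈ t \ {u, v} := by simp [hw]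
    simp only [Finset.mem_sdiff, mem_insert, mem_singleton, not_or] at hwm
    refine mem_image.2 ⟨w, ?_, ?_⟩
    · simp only [commonNbrs, mem_filter, mem_univ, true_and]
      exact ⟨ht.isClique hwm.1 hu hwm.2.1, ht.isClique hwm.1 hv hwm.2.2⟩
    · rw [← union_sdiff_of_subset hsub, hw]
      ext x
      simp
  calc 6 * cliqueCount G 3 = ∑ t ∈ G.cliqueFinset 3, #{p ∈ adjPairs G | p.1 ∈ t ∧ p.2 ∈ t} := by
        rw [sum_congr rfl h2, sum_const, h1, smul_eq_mul, mul_comm]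
    _ = ∑ p ∈ adjPairs G, #{t ∈ G.cliqueFinset 3 | p.1 ∈ t ∧ p.2 ∈ t} :=
        sum_card_bipartiteAbove_eq_sum_card_bipartiteBelow
          (fun (t : Finset V) (p : V × V) => p.1 ∈ t ∧ p.2 ∈ t)
    _ ≤ _ := sum_le_sum h3

variable {G} in
lemma IsDRegular.card_adjPairs {d : ℕ} (h : IsDRegular G d) :
    #(adjPairs G) = Fintype.card V * d := by
  have : adjPairs G = (univ.sigma fun v => G.neighborFinset v).map
      (Equiv.sigmaEquivProd V V).toEmbedding := by
    ext ⟨u, v⟩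
    simp [adjPairs]
  rw [this, card_map, card_sigma]
  simp [h.degree_eq]

variable {G} in
lemma IsDRegular.card_commonNbrs_lt {d : ℕ} (h : IsDRegular G d) {u v : V} (huv : G.Adj u v) :
    #(commonNbrs G u v) + 1 ≤ d := by
  rw [← h.degree_eq u, ← G.card_neighborFinset_eq_degree]
  refine card_lt_card (ssubset_iff_of_subset ?_ |>.2 ⟨v, ?_, ?_⟩)
  · intro w hw
    simp only [commonNbrs, mem_filter, mem_univ, true_and] at hw
    simpa using hw.1.symm
  · simpa using huv
  · simp [commonNbrs]

/-- The edges, oriented along the ordering `σ`, for which no common neighbour of the endpoints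
comes before both of them. -/
def leadingPairs [LinearOrder V] (σ : Equiv.Perm V) : Finset (V × V) :=
  {p ∈ adjPairs G | σ p.1 ≤ σ p.2 ∧ ∀ w ∈ commonNbrs G p.1 p.2, σ p.1 ≤ σ w}

variable {G} in
lemma IsDRegular.exists_card_leadingPairs_le [LinearOrder V] {d : ℕ} (h : IsDRegular G d) :
    ∃ σ : Equiv.Perm V, (#(leadingPairs G σ) : ℝ) ≤
      (Fintype.card V * d - 6 * cliqueCount G 3 / (d + 1)) / 2 := by
  set R : ℝ := (Fintype.card V * d - 6 * cliqueCount G 3 / (d + 1)) / 2 with hR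
  have hpair : ∀ p ∈ adjPairs G,
      (#{σ : Equiv.Perm V | σ p.1 ≤ σ p.2 ∧ ∀ w ∈ commonNbrs G p.1 p.2, σ p.1 ≤ σ w} : ℝ) ≤
        (Fintype.card V).factorial * ((1 - #(commonNbrs G p.1 p.2) / (d + 1)) / 2) := by
    rintro ⟨u, v⟩ hp
    have huv : G.Adj u v := by simpa [adjPairs] using hp
    have hlt := h.card_commonNbrs_lt huv
    have hcard : #(insert u (insert v (commonNbrs G u v))) = #(commonNbrs G u v) + 2 := by
      rw [card_insert_of_notMem, card_insert_of_notMem]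
      · simp [commonNbrs]
      · simp [commonNbrs, huv.ne]
    have hmin := card_mul_card_perm_min_le (insert u (insert v (commonNbrs G u v)))
      (mem_insert_self u _)
    rw [hcard] at hmin
    simp only [mem_insert, forall_eq_or_imp, le_refl, true_and] at hmin
    dsimp only
    set k := #(commonNbrs G u v)
    set M := #{σ : Equiv.Perm V | σ u ≤ σ v ∧ ∀ w ∈ commonNbrs G u v, σ u ≤ σ w}
    have hmin' : ((k : ℝ) + 2) * M ≤ (Fintype.card V).factorial := by exact_mod_cast hmin
    have hlt' : (k : ℝ) + 1 ≤ d := by exact_mod_cast hlt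
    have hk : (0 : ℝ) ≤ k := by positivity
    have hd : (0 : ℝ) < (d : ℝ) + 1 := by positivity
    have h1 : (M : ℝ) ≤ (Fintype.card V).factorial * (1 / ((k : ℝ) + 2)) := by
      rw [mul_one_div, le_div_iff₀ (by positivity)]
      linarith
    refine h1.trans (mul_le_mul_of_nonneg_left ?_ (by positivity))
    have h2 : (k : ℝ) / (d + 1) ≤ k / (k + 2) :=
      div_le_div_of_nonneg_left hk (by positivity) (by linarith)
    have h3 : (1 : ℝ) / (k + 2) = (1 - k / (k + 2)) / 2 := by
      field_simp
      ring
    linarith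
  have htri : (6 * cliqueCount G 3 : ℝ) ≤ ∑ p ∈ adjPairs G, (#(commonNbrs G p.1 p.2) : ℝ) := by
    exact_mod_cast six_mul_cliqueCount_le G
  have hsum : ∑ σ : Equiv.Perm V, (#(leadingPairs G σ) : ℝ) ≤ ∑ _σ : Equiv.Perm V, R := by
    calc ∑ σ : Equiv.Perm V, (#(leadingPairs G σ) : ℝ)
        = ∑ p ∈ adjPairs G,
          (#{σ : Equiv.Perm V | σ p.1 ≤ σ p.2 ∧ ∀ w ∈ commonNbrs G p.1 p.2, σ p.1 ≤ σ w} : ℝ) := by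
          exact_mod_cast sum_card_bipartiteAbove_eq_sum_card_bipartiteBelow
            (s := (univ : Finset (Equiv.Perm V))) (t := adjPairs G)
            (fun (σ : Equiv.Perm V) (p : V × V) =>
              σ p.1 ≤ σ p.2 ∧ ∀ w ∈ commonNbrs G p.1 p.2, σ p.1 ≤ σ w)
      _ ≤ ∑ p ∈ adjPairs G,
          (Fintype.card V).factorial * ((1 - #(commonNbrs G p.1 p.2) / ((d : ℝ) + 1)) / 2) :=
          sum_le_sum hpair
      _ = (Fintype.card V).factorial * ((Fintype.card V * d -
          (∑ p ∈ adjPairs G, (#(commonNbrs G p.1 p.2) : ℝ)) / (d + 1)) / 2) := by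
          rw [← mul_sum, ← sum_div, sum_sub_distrib, sum_const, h.card_adjPairs, ← sum_div]
          simp
      _ ≤ (Fintype.card V).factorial * R := by
          rw [hR]
          gcongr
      _ = ∑ _σ : Equiv.Perm V, R := by
          rw [sum_const, card_univ, Fintype.card_perm, nsmul_eq_mul]
  obtain ⟨σ, -, hσ⟩ := exists_le_of_sum_le univ_nonempty hsum
  exact ⟨σ, hσ⟩

end Triangles

section Decoding

variable {V : Type*} {d : ℕ}

/-- The labelled half-edges recovered from a set `F` of labelled edges by closing up paths of
length two according to the table `L`: `Reach F L a i b` says that `b` is recovered as the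
neighbour of `a` with label `i`. -/
inductive Reach (F : Finset ((V × Fin d) × (V × Fin d))) (L : V → Fin d → Fin d → Option (Fin d)) :
    V → Fin d → V → Prop
  | left {a b : V} {i j : Fin d} (h : ((a, i), (b, j)) ∈ F) : Reach F L a i b
  | right {a b : V} {i j : Fin d} (h : ((a, i), (b, j)) ∈ F) : Reach F L b j a
  | tri {a b c : V} {i j k : Fin d} (ha : Reach F L b i a) (hc : Reach F L b j c)
      (h : L b i j = some k) : Reach F L a k c

/-- The graph recovered from the edges `F` and the table `L`. -/
def decodeGraph (F : Finset ((V × Fin d) × (V × Fin d)))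
    (L : V → Fin d → Fin d → Option (Fin d)) : SimpleGraph V :=
  SimpleGraph.fromRel fun a b => ∃ i, Reach F L a i b

open Finset in
lemma IsDRegular.exists_decodeGraph_eq [Fintype V] [LinearOrder V] {G : SimpleGraph V}
    [DecidableRel G.Adj] (h : IsDRegular G d) (hd : d ≠ 0) (σ : Equiv.Perm V) :
    ∃ F : Finset ((V × Fin d) × (V × Fin d)), ∃ L : V → Fin d → Fin d → Option (Fin d),
      #F ≤ #(leadingPairs G σ) ∧ decodeGraph F L = G := by
  obtain ⟨nb, lab, hnb, hlab⟩ : ∃ nb : V → Fin d → V, ∃ lab : V → V → Fin d,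
      (∀ v i, G.Adj v (nb v i)) ∧ ∀ v w, G.Adj v w → nb v (lab v w) = w := by
    have e : ∀ v, G.neighborSet v ≃ Fin d := fun v =>
      Fintype.equivFinOfCardEq (by rw [G.card_neighborSet_eq_degree, h.degree_eq])
    refine ⟨fun v i => (e v).symm i,
      fun v w => if hvw : G.Adj v w then e v ⟨w, hvw⟩ else ⟨0, Nat.pos_of_ne_zero hd⟩,
      fun v i => ((e v).symm i).2, fun v w hvw => ?_⟩
    simp [hvw]
  set F : Finset ((V × Fin d) × (V × Fin d)) :=
    (leadingPairs G σ).image fun p => ((p.1, lab p.1 p.2), (p.2, lab p.2 p.1)) with hF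
  set L : V → Fin d → Fin d → Option (Fin d) := fun b i j =>
    if G.Adj (nb b i) (nb b j) then some (lab (nb b i) (nb b j)) else none with hL
  have hmemF : ∀ {a b i j}, ((a, i), (b, j)) ∈ F → G.Adj a b ∧ i = lab a b ∧ j = lab b a := by
    intro a b i j hab
    simp only [hF, mem_image, Prod.mk.injEq, Prod.exists] at hab
    obtain ⟨x, y, hxy, ⟨rfl, rfl⟩, rfl, rfl⟩ := hab
    simp only [leadingPairs, adjPairs, mem_filter, mem_univ, true_and] at hxy
    exact ⟨hxy.1, rfl, rfl⟩
  have hsound : ∀ {a i b}, Reach F L a i b → nb a i = b := by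
    intro a i b hr
    induction hr with
    | left hm => obtain ⟨hadj, rfl, -⟩ := hmemF hm; exact hlab _ _ hadj
    | right hm => obtain ⟨hadj, -, rfl⟩ := hmemF hm; exact hlab _ _ hadj.symm
    | tri _ _ hk ha hc =>
      subst ha hc
      simp only [hL, Option.ite_none_right_eq_some, Option.some.injEq] at hk
      obtain ⟨hadj, rfl⟩ := hk
      exact hlab _ _ hadj
  have hcomplete : ∀ y x : V, x < y → ∀ u v, σ u = x → σ v = y → G.Adj u v →
      Reach F L u (lab u v) v ∧ Reach F L v (lab v u) u := by
    intro y
    induction y using WellFoundedLT.induction with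
    | ind y ihy =>
    intro x
    induction x using WellFoundedLT.induction with
    | ind x ihx =>
    rintro hxy u v rfl rfl huv
    by_cases hlead : (u, v) ∈ leadingPairs G σ
    · have hm : ((u, lab u v), (v, lab v u)) ∈ F := mem_image.2 ⟨(u, v), hlead, rfl⟩
      exact ⟨.left hm, .right hm⟩
    · have : ∃ w ∈ commonNbrs G u v, σ w < σ u := by
        by_contra! hcon
        exact hlead (by simpa [leadingPairs, adjPairs, huv, hxy.le] using hcon)
      obtain ⟨w, hw, hwu⟩ := this
      simp only [commonNbrs, mem_filter, mem_univ, true_and] at hw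
      have h1 := (ihy _ hxy _ hwu w u rfl rfl hw.1).1
      have h2 := (ihx _ hwu (hwu.trans hxy) w v rfl rfl hw.2).1
      exact ⟨.tri h1 h2 (by simp [hL, hlab _ _ hw.1, hlab _ _ hw.2, huv]),
        .tri h2 h1 (by simp [hL, hlab _ _ hw.1, hlab _ _ hw.2, huv.symm])⟩
  refine ⟨F, L, card_image_le, ?_⟩
  ext u v
  rw [decodeGraph, SimpleGraph.fromRel_adj]
  constructor
  · rintro ⟨-, ⟨i, hi⟩ | ⟨i, hi⟩⟩
    · exact hsound hi ▸ hnb u i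
    · exact hsound hi ▸ (hnb v i).symm
  · intro huv
    refine ⟨huv.ne, Or.inl ⟨lab u v, ?_⟩⟩
    rcases lt_or_gt_of_ne (fun he => huv.ne (σ.injective he)) with hlt | hlt
    · exact (hcomplete _ _ hlt u v rfl rfl huv).1
    · exact (hcomplete _ _ hlt v u rfl rfl huv.symm).2

end Decoding

open Finset in
lemma card_filter_card_le {α : Type*} [Fintype α] (s : ℕ) :
    #{F : Finset α | #F ≤ s} ≤ ∑ j ∈ range (s + 1), (Fintype.card α).choose j := by
  classical
  have : ({F : Finset α | #F ≤ s} : Finset (Finset α)) ⊆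
      (range (s + 1)).biUnion fun j => powersetCard j univ := by
    intro F hF
    simpa [mem_powersetCard, Nat.lt_succ_iff] using hF
  refine (card_le_card this).trans (card_biUnion_le.trans ?_)
  simp

open Finset in
lemma card_Gdc_le {n d : ℕ} (hd : d ≠ 0) (c : ℝ) {s : ℕ}
    (hs : ((n : ℝ) * d - 6 * (c * ((n : ℝ) / 3 * (d.choose 2))) / (d + 1)) / 2 < s + 1) :
    Nat.card (Gdc n d c) ≤
      (∑ j ∈ range (s + 1), ((n * d) * (n * d)).choose j) * (d + 1) ^ (n * (d * d)) := by
  classical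
  set A : Finset (Finset ((Fin n × Fin d) × (Fin n × Fin d))) := {F | #F ≤ s}
  set B : Finset (Fin n → Fin d → Fin d → Option (Fin d)) := univ
  have hsub : Gdc n d c ⊆ ((A ×ˢ B).image fun p => decodeGraph p.1 p.2 : Set _) := by
    rintro G ⟨hreg, htri⟩
    obtain ⟨σ, hσ⟩ := hreg.exists_card_leadingPairs_le
    obtain ⟨F, L, hF, hdec⟩ := hreg.exists_decodeGraph_eq hd σ
    refine mem_coe.2 (mem_image.2 ⟨(F, L), ?_, hdec⟩)
    have hlt : (#(leadingPairs G σ) : ℝ) < s + 1 := by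
      refine lt_of_le_of_lt (hσ.trans ?_) hs
      rw [Fintype.card_fin]
      gcongr
    have hlt' : #(leadingPairs G σ) < s + 1 := by exact_mod_cast hlt
    simp only [A, B, mem_product, mem_filter, mem_univ, true_and, and_true]
    omega
  calc Nat.card (Gdc n d c) = (Gdc n d c).ncard := rfl
    _ ≤ #((A ×ˢ B).image fun p => decodeGraph p.1 p.2) := by
        rw [← Set.ncard_coe_finset]
        exact Set.ncard_le_ncard hsub (finite_toSet _)
    _ ≤ #A * #B := card_image_le.trans (card_product _ _).le
    _ ≤ _ := by
        refine Nat.mul_le_mul ?_ ?_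
        · simpa using card_filter_card_le (α := (Fin n × Fin d) × (Fin n × Fin d)) s
        · simp only [B, card_univ, Fintype.card_fun, Fintype.card_fin, Fintype.card_option]
          rw [← pow_mul, ← pow_mul]
          exact (congrArg _ (by ring)).le

section Planted

variable {A Q : Type*} {d : ℕ}

/-- The adjacency relation of `plantedGraph`. -/
def PlantedAdj (τ : Fin d → Equiv.Perm A) (ρ : Fin d → Fin d → Equiv.Perm Q) :
    (A × Fin (d + 1)) ⊕ ((Fin d × Q) ⊕ (Fin d × Q)) →
      (A × Fin (d + 1)) ⊕ ((Fin d × Q) ⊕ (Fin d × Q)) → Prop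
  | .inl (x, i), .inl (y, j) =>
    i ≠ j ∧ (Fin.cons 1 τ : Fin (d + 1) → Equiv.Perm A) i x =
      (Fin.cons 1 τ : Fin (d + 1) → Equiv.Perm A) j y
  | .inr (.inl (i, x)), .inr (.inr (j, y)) => ρ i j x = y
  | .inr (.inr (j, y)), .inr (.inl (i, x)) => ρ i j x = y
  | _, _ => False

/-- The disjoint union of `(d + 1)`-cliques, laid out across `d + 1` copies of `A` by the
permutations `τ`, and of a bipartite graph between two families of `d` copies of `Q`, in which
the permutations `ρ` give a perfect matching for every pair of copies. -/
def plantedGraph (τ : Fin d → Equiv.Perm A) (ρ : Fin d → Fin d → Equiv.Perm Q) :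
    SimpleGraph ((A × Fin (d + 1)) ⊕ ((Fin d × Q) ⊕ (Fin d × Q))) where
  Adj := PlantedAdj τ ρ
  symm := ⟨by
    rintro (⟨x, i⟩ | ⟨i, x⟩ | ⟨i, x⟩) (⟨y, j⟩ | ⟨j, y⟩ | ⟨j, y⟩) h
    all_goals simp only [PlantedAdj] at h ⊢
    · exact ⟨h.1.symm, h.2.symm⟩
    · exact h
    · exact h⟩
  loopless := ⟨by
    rintro (⟨x, i⟩ | ⟨i, x⟩ | ⟨i, x⟩) h
    all_goals simp [PlantedAdj] at h⟩

lemma isDRegular_plantedGraph (τ : Fin d → Equiv.Perm A) (ρ : Fin d → Fin d → Equiv.Perm Q) :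
    IsDRegular (plantedGraph τ ρ) d := by
  rintro (⟨x, i⟩ | ⟨i, x⟩ | ⟨i, x⟩)
  · set τ' : Fin (d + 1) → Equiv.Perm A := Fin.cons 1 τ
    have : (plantedGraph τ ρ).neighborSet (.inl (x, i)) =
        (fun j => .inl ((τ' j).symm (τ' i x), j)) '' ({i}ᶜ : Set (Fin (d + 1))) := by
      ext (⟨y, j⟩ | ⟨j, y⟩ | ⟨j, y⟩)
      · simp only [SimpleGraph.mem_neighborSet, plantedGraph, PlantedAdj, Set.mem_image,
          Set.mem_compl_iff, Set.mem_singleton_iff, Sum.inl.injEq, Prod.mk.injEq]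
        constructor
        · rintro ⟨hij, h⟩
          exact ⟨j, fun he => hij he.symm, by rw [Equiv.symm_apply_eq]; exact h, rfl⟩
        · rintro ⟨k, hk, h, rfl⟩
          rw [Equiv.symm_apply_eq] at h
          exact ⟨fun he => hk he.symm, h⟩
      all_goals simp [plantedGraph, PlantedAdj]
    rw [this, Set.ncard_image_of_injective, Set.ncard_compl, Set.ncard_singleton]
    · simp
    · intro j k hjk
      simp only [Sum.inl.injEq, Prod.mk.injEq] at hjk
      exact hjk.2
  · have : (plantedGraph τ ρ).neighborSet (.inr (.inl (i, x))) =
        (fun j => .inr (.inr (j, ρ i j x))) '' (Set.univ : Set (Fin d)) := by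
      ext (⟨y, j⟩ | ⟨j, y⟩ | ⟨j, y⟩) <;> simp [plantedGraph, PlantedAdj]
    rw [this, Set.ncard_image_of_injective, Set.ncard_univ]
    · simp
    · intro j k hjk
      simp only [Sum.inr.injEq, Prod.mk.injEq] at hjk
      exact hjk.1
  · have : (plantedGraph τ ρ).neighborSet (.inr (.inr (i, x))) =
        (fun j => .inr (.inl (j, (ρ j i).symm x))) '' (Set.univ : Set (Fin d)) := by
      ext (⟨y, j⟩ | ⟨j, y⟩ | ⟨j, y⟩)
      · simp [plantedGraph, PlantedAdj]
      · simp only [SimpleGraph.mem_neighborSet, plantedGraph, PlantedAdj, Set.image_univ,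
          Set.mem_range, Sum.inr.injEq, Sum.inl.injEq, Prod.mk.injEq]
        constructor
        · rintro rfl
          exact ⟨j, rfl, Equiv.symm_apply_apply _ _⟩
        · rintro ⟨k, rfl, rfl⟩
          exact Equiv.apply_symm_apply _ _
      · simp [plantedGraph, PlantedAdj]
    rw [this, Set.ncard_image_of_injective, Set.ncard_univ]
    · simp
    · intro j k hjk
      simp only [Sum.inr.injEq, Sum.inl.injEq, Prod.mk.injEq] at hjk
      exact hjk.1

lemma plantedGraph_injective :
    Function.Injective fun p : (Fin d → Equiv.Perm A) × (Fin d → Fin d → Equiv.Perm Q) =>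
      plantedGraph p.1 p.2 := by
  rintro ⟨τ, ρ⟩ ⟨τ', ρ'⟩ h
  have hadj : ∀ u v, PlantedAdj τ ρ u v ↔ PlantedAdj τ' ρ' u v := fun u v =>
    iff_of_eq (congrArg (fun G : SimpleGraph _ => G.Adj u v) h)
  refine Prod.ext (funext fun i => Equiv.ext fun x => ?_)
    (funext fun i => funext fun j => Equiv.ext fun x => ?_)
  · have := hadj (.inl (x, i.succ)) (.inl (τ i x, 0))
    simp only [PlantedAdj, Fin.cons_succ, Fin.cons_zero, Equiv.Perm.one_apply] at this
    exact (this.1 ⟨Fin.succ_ne_zero i, trivial⟩).2.symm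
  · have := hadj (.inr (.inl (i, x))) (.inr (.inr (j, ρ i j x)))
    simp only [PlantedAdj] at this
    exact (this.1 trivial).symm

end Planted

lemma card_mul_choose_le_cliqueCount {V A ι : Type*} [Fintype V] [Fintype A] [Fintype ι]
    {G : SimpleGraph V} (f : A × ι → V) (hf : f.Injective)
    (hadj : ∀ x i j, i ≠ j → G.Adj (f (x, i)) (f (x, j))) {k : ℕ} (hk : k ≠ 0) :
    Fintype.card A * (Fintype.card ι).choose k ≤ cliqueCount G k := by
  classical
  have hinj : ∀ x : A, Function.Injective fun i => f (x, i) := fun x i j h => by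
    simpa using hf h
  let g : A × {s : Finset ι // s ∈ Finset.powersetCard k Finset.univ} →
      {t : Finset V // G.IsNClique k t} := fun p =>
    ⟨p.2.1.image fun i => f (p.1, i), by
      obtain ⟨x, s, hs⟩ := p
      rw [Finset.mem_powersetCard] at hs
      refine ⟨?_, by rw [Finset.card_image_of_injective _ (hinj x), hs.2]⟩
      simp only [Finset.coe_image]
      rintro _ ⟨i, -, rfl⟩ _ ⟨j, -, rfl⟩ hij
      exact hadj x i j fun h => hij (by rw [h])⟩
  have hg : g.Injective := by
    rintro ⟨x, s, hs⟩ ⟨y, t, ht⟩ h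
    simp only [g, Subtype.mk.injEq] at h
    obtain ⟨i, hi⟩ : s.Nonempty := by
      rw [← Finset.card_ne_zero, (Finset.mem_powersetCard.1 hs).2]
      exact hk
    have hmem : f (x, i) ∈ t.image fun j => f (y, j) := h ▸ Finset.mem_image_of_mem _ hi
    obtain ⟨j, -, hj⟩ := Finset.mem_image.1 hmem
    obtain rfl : y = x := congrArg Prod.fst (hf hj)
    obtain rfl := Finset.image_injective (hinj y) h
    rfl
  have := Nat.card_le_card_of_injective g hg
  simpa [cliqueCount, Nat.card_eq_fintype_card, Fintype.card_prod] using this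

lemma factorial_pow_le_card_Gdc {n d a q : ℕ} (hn : a * (d + 1) + (d * q + d * q) = n) {c : ℝ}
    (hc : c * n ≤ a * (d + 1)) :
    a.factorial ^ d * q.factorial ^ (d * d) ≤ Nat.card (Gdc n d c) := by
  have e : (Fin a × Fin (d + 1)) ⊕ ((Fin d × Fin q) ⊕ (Fin d × Fin q)) ≃ Fin n :=
    Fintype.equivFinOfCardEq (by simpa using hn)
  have hmem : ∀ p : (Fin d → Equiv.Perm (Fin a)) × (Fin d → Fin d → Equiv.Perm (Fin q)),
      (plantedGraph p.1 p.2).comap e.symm ∈ Gdc n d c := by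
    rintro ⟨τ, ρ⟩
    constructor
    · intro v
      have : ((plantedGraph τ ρ).comap e.symm).neighborSet v =
          e '' (plantedGraph τ ρ).neighborSet (e.symm v) := by
        ext w
        simp [Equiv.image_eq_preimage_symm]
      rw [this, Set.ncard_image_of_injective _ e.injective, isDRegular_plantedGraph]
    · set τ' : Fin (d + 1) → Equiv.Perm (Fin a) := Fin.cons 1 τ
      have hcount := card_mul_choose_le_cliqueCount (G := (plantedGraph τ ρ).comap e.symm)
        (fun p : Fin a × Fin (d + 1) => e (.inl ((τ' p.2).symm p.1, p.2)))
        (by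
          rintro ⟨x, i⟩ ⟨y, j⟩ h
          simp only [EmbeddingLike.apply_eq_iff_eq, Sum.inl.injEq, Prod.mk.injEq] at h
          obtain ⟨h, rfl⟩ := h
          simpa using h)
        (by
          intro x i j hij
          simp only [SimpleGraph.comap_adj, Equiv.symm_apply_apply]
          exact ⟨hij, ((τ' i).apply_symm_apply x).trans ((τ' j).apply_symm_apply x).symm⟩)
        (k := 3) (by norm_num)
      rw [Fintype.card_fin, Fintype.card_fin] at hcount
      have hchoose : ((d + 1 : ℕ) : ℝ) * d.choose 2 = (d + 1).choose 3 * 3 := by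
        exact_mod_cast Nat.add_one_mul_choose_eq d 2
      have hcount' : (a : ℝ) * (d + 1).choose 3 ≤
          cliqueCount ((plantedGraph τ ρ).comap e.symm) 3 := by exact_mod_cast hcount
      refine le_trans ?_ hcount'
      have := mul_le_mul_of_nonneg_right hc (Nat.cast_nonneg (α := ℝ) (d.choose 2))
      push_cast at hchoose
      nlinarith
  let g : (Fin d → Equiv.Perm (Fin a)) × (Fin d → Fin d → Equiv.Perm (Fin q)) → Gdc n d c :=
    fun p => ⟨_, hmem p⟩
  have hg : g.Injective := by
    intro p p' h
    simp only [g, Subtype.mk.injEq] at h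
    refine plantedGraph_injective (SimpleGraph.ext (funext fun u => funext fun v => ?_))
    simpa using congrArg (fun G : SimpleGraph (Fin n) => G.Adj (e u) (e v)) h
  have := Nat.card_le_card_of_injective g hg
  simpa [Nat.card_eq_fintype_card, Fintype.card_perm, ← pow_mul] using this

open Finset in
lemma sum_choose_le {n d s : ℕ} {r : ℝ} (hn : 1 ≤ n) (hd : 1 ≤ d) (hs : (s : ℝ) ≤ r)
    (hsd : s ≤ d * n) :
    ((∑ j ∈ range (s + 1), ((n * d) * (n * d)).choose j : ℕ) : ℝ) ≤
      (n : ℝ) ^ r * ((d : ℝ) ^ 2) ^ (d * n) * Real.exp n := by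
  have hn' : (1 : ℝ) ≤ n := by exact_mod_cast hn
  have hd' : (1 : ℝ) ≤ d := by exact_mod_cast hd
  calc ((∑ j ∈ range (s + 1), ((n * d) * (n * d)).choose j : ℕ) : ℝ)
      ≤ ∑ j ∈ range (s + 1), (n : ℝ) ^ r * ((d : ℝ) ^ 2) ^ (d * n) * ((n : ℝ) ^ j / j.factorial) := by
        rw [Nat.cast_sum]
        refine sum_le_sum fun j hj => ?_
        have hjs : j ≤ s := Nat.lt_succ_iff.1 (mem_range.1 hj)
        have h1 : (n : ℝ) ^ j ≤ (n : ℝ) ^ r := by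
          rw [← Real.rpow_natCast]
          exact Real.rpow_le_rpow_of_exponent_le hn' (le_trans (by exact_mod_cast hjs) hs)
        have h2 : ((d : ℝ) ^ 2) ^ j ≤ ((d : ℝ) ^ 2) ^ (d * n) :=
          pow_le_pow_right₀ (one_le_pow₀ hd') (hjs.trans hsd)
        calc (((n * d) * (n * d)).choose j : ℝ) ≤ (((n * d) * (n * d) : ℕ) : ℝ) ^ j / j.factorial :=
              Nat.choose_le_pow_div j _
          _ = (n : ℝ) ^ j * ((d : ℝ) ^ 2) ^ j * ((n : ℝ) ^ j / j.factorial) := by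
              push_cast
              rw [show (n : ℝ) * d * (n * d) = n * (d ^ 2) * n by ring, mul_pow, mul_pow]
              ring
          _ ≤ _ := by gcongr
    _ ≤ _ := by
        rw [← mul_sum]
        exact mul_le_mul_of_nonneg_left (Real.sum_le_exp_of_nonneg (by positivity) _)
          (by positivity)

/-- The leading coefficient of `log |G_{d,c}(n)|` on the scale `n log n`. -/
noncomputable def logRate (d : ℕ) (c : ℝ) : ℝ := (d : ℝ) / 2 * (1 - c * (d - 1) / (d + 1))

lemma logRate_nonneg {d : ℕ} {c : ℝ} (hd : 1 ≤ d) (hc1 : c ≤ 1) : 0 ≤ logRate d c := by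
  have hd' : (1 : ℝ) ≤ d := by exact_mod_cast hd
  have : c * ((d : ℝ) - 1) / (d + 1) ≤ 1 := by
    rw [div_le_one (by positivity)]
    nlinarith
  unfold logRate
  exact mul_nonneg (by positivity) (by linarith)

lemma logRate_le {d : ℕ} {c : ℝ} (hd : 1 ≤ d) (hc0 : 0 ≤ c) : logRate d c ≤ d := by
  have hd' : (1 : ℝ) ≤ d := by exact_mod_cast hd
  have : 0 ≤ c * ((d : ℝ) - 1) / (d + 1) :=
    div_nonneg (mul_nonneg hc0 (by linarith)) (by positivity)
  unfold logRate
  nlinarith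

lemma log_card_Gdc_le {d : ℕ} (hd : 1 ≤ d) {c : ℝ} (hc0 : 0 ≤ c) (hc1 : c ≤ 1) {n : ℕ}
    (hn : 1 ≤ n) (hpos : 0 < Nat.card (Gdc n d c)) :
    Real.log (Nat.card (Gdc n d c)) ≤ logRate d c * n * Real.log n +
      (d * Real.log ((d : ℝ) ^ 2) + 1 + d * d * Real.log (d + 1)) * n := by
  have hn' : (0 : ℝ) < n := by exact_mod_cast hn
  have hd' : (0 : ℝ) < d := by exact_mod_cast hd
  have hr0 : 0 ≤ logRate d c * n := mul_nonneg (logRate_nonneg hd hc1) hn'.le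
  set s := ⌊logRate d c * n⌋₊
  have hs : (s : ℝ) ≤ logRate d c * n := Nat.floor_le hr0
  have hsd : s ≤ d * n := by
    have : (s : ℝ) ≤ d * n := hs.trans (mul_le_mul_of_nonneg_right (logRate_le hd hc0) hn'.le)
    exact_mod_cast this
  have hcard := card_Gdc_le (n := n) (Nat.one_le_iff_ne_zero.1 hd) c (s := s) (by
    have h2 : logRate d c * n < s + 1 := Nat.lt_floor_add_one _
    refine lt_of_eq_of_lt ?_ h2
    rw [Nat.cast_choose_two, logRate]
    field_simp
    ring)
  have hbound : (Nat.card (Gdc n d c) : ℝ) ≤ (n : ℝ) ^ (logRate d c * n) *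
      ((d : ℝ) ^ 2) ^ (d * n) * Real.exp n * ((d : ℝ) + 1) ^ (n * (d * d)) := by
    refine le_trans (b := (((∑ j ∈ Finset.range (s + 1), ((n * d) * (n * d)).choose j) *
      (d + 1) ^ (n * (d * d)) : ℕ) : ℝ)) (by exact_mod_cast hcard) ?_
    rw [Nat.cast_mul]
    push_cast [-Nat.cast_sum]
    exact mul_le_mul_of_nonneg_right (sum_choose_le hn hd hs hsd) (by positivity)
  refine (Real.log_le_log (by exact_mod_cast hpos) hbound).trans (le_of_eq ?_)
  rw [Real.log_mul (by positivity) (by positivity), Real.log_mul (by positivity) (by positivity),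
    Real.log_mul (by positivity) (by positivity), Real.log_rpow hn',
    Real.log_pow (n := d * n), Real.log_exp,
    Real.log_pow (n := n * (d * d))]
  push_cast
  ring

lemma mul_log_sub_le_log_factorial_s3 {n : ℕ} (hn : 1 ≤ n) (a : ℕ) :
    a * Real.log n - n ≤ Real.log a.factorial := by
  have hn' : (0 : ℝ) < n := by exact_mod_cast hn
  have h := Real.pow_div_factorial_le_exp (n : ℝ) hn'.le a
  have h2 := Real.log_le_log (by positivity) h
  rw [Real.log_div (by positivity) (by positivity), Real.log_pow, Real.log_exp] at h2
  linarith

lemma exists_eq_clique_add_bipartite {n d : ℕ} (hd : 1 ≤ d) (heven : Even (n * d)) {m : ℕ}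
    (hm : (m + 2 * d) * (d + 1) ≤ n) :
    ∃ a q : ℕ, a * (d + 1) + (d * q + d * q) = n ∧ m ≤ a ∧ a ≤ m + 2 * d := by
  set t := (n * (d + 1) + (2 * d - 1) * m) % (2 * d) with ht
  have ht1 : t ≤ 2 * d := (Nat.mod_lt _ (by omega)).le
  have hle : (m + t) * (d + 1) ≤ n := le_trans (Nat.mul_le_mul_right _ (by omega)) hm
  have hdvd : 2 * d ∣ n - (m + t) * (d + 1) := by
    rw [← Int.natCast_dvd_natCast, Nat.cast_sub hle]
    have h1 : ((2 * d : ℕ) : ℤ) ∣ (n * (d + 1) + (2 * d - 1) * m : ℤ) - t := by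
      have := Int.dvd_sub_self_of_emod_eq (a := (n * (d + 1) + (2 * d - 1) * m : ℤ))
        (b := ((2 * d : ℕ) : ℤ)) (c := t) (by
          rw [ht]
          push_cast [Nat.cast_sub (show 1 ≤ 2 * d by omega)]
          rfl)
      exact (dvd_sub_comm).1 this
    obtain ⟨k, hk⟩ := h1
    obtain ⟨l, hl⟩ := heven
    have hl' : (n * d : ℤ) = l + l := by exact_mod_cast hl
    refine ⟨k * (d + 1) - m * (d + 1) - n - l, ?_⟩
    push_cast at hk ⊢
    linear_combination (d + 1 : ℤ) * hk - (d : ℤ) * hl'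
  obtain ⟨q, hq⟩ := hdvd
  refine ⟨m + t, q, ?_, by omega, by omega⟩
  have : d * q + d * q = 2 * d * q := by ring
  omega

lemma eventually_le_log_card_Gdc {d : ℕ} (hd : 1 ≤ d) {c : ℝ} (hc0 : 0 ≤ c) (hc1 : c < 1) :
    ∃ K : ℝ, ∀ᶠ n : ℕ in atTop ⊓ 𝓟 {n : ℕ | Even (n * d)}, 0 < Nat.card (Gdc n d c) ∧
      logRate d c * n * Real.log n - K * n ≤ Real.log (Nat.card (Gdc n d c)) := by
  have hd' : (1 : ℝ) ≤ d := by exact_mod_cast hd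
  refine ⟨(2 * d + 1) * (d * (d - 1) / 2) + (d + d * d), ?_⟩
  rw [eventually_inf_principal]
  have hlarge : ∀ᶠ n : ℕ in atTop, (2 * d + 1) * (d + 1) / (1 - c) ≤ n :=
    tendsto_natCast_atTop_atTop.eventually_ge_atTop _
  filter_upwards [hlarge, eventually_ge_atTop 1] with n hn hn1 heven
  have hn' : (1 : ℝ) ≤ n := by exact_mod_cast hn1
  set m := ⌈c * n / (d + 1)⌉₊
  have hm1 : c * n / (d + 1) ≤ m := Nat.le_ceil _
  have hm2 : (m : ℝ) < c * n / (d + 1) + 1 := Nat.ceil_lt_add_one (by positivity)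
  have hm : (m + 2 * d) * (d + 1) ≤ n := by
    rw [div_le_iff₀ (by linarith)] at hn
    have h1 : ((m : ℝ) + 2 * d) * (d + 1) ≤ n := by
      have h2 : ((m : ℝ) + 2 * d) * (d + 1) ≤ (c * n / (d + 1) + 1 + 2 * d) * (d + 1) := by
        gcongr
      have h3 : (c * n / (d + 1) + 1 + 2 * d) * ((d : ℝ) + 1) = c * n + (2 * d + 1) * (d + 1) := by
        field_simp
        ring
      linarith
    exact_mod_cast h1
  obtain ⟨a, q, haq, ha1, ha2⟩ := exists_eq_clique_add_bipartite hd heven hm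
  have ha1' : (m : ℝ) ≤ a := by exact_mod_cast ha1
  have ha2' : (a : ℝ) ≤ m + 2 * d := by exact_mod_cast ha2
  have haq' : (a : ℝ) * (d + 1) + (d * q + d * q) = n := by exact_mod_cast haq
  have hcard := factorial_pow_le_card_Gdc haq (c := c) (by
    have := hm1.trans ha1'
    rwa [div_le_iff₀ (by positivity)] at this)
  have hpos : 0 < a.factorial ^ d * q.factorial ^ (d * d) := by positivity
  refine ⟨hpos.trans_le hcard, ?_⟩
  have hlog := Real.log_le_log (by exact_mod_cast hpos) (Nat.cast_le (α := ℝ).2 hcard)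
  push_cast at hlog
  rw [Real.log_mul (by positivity) (by positivity), Real.log_pow, Real.log_pow] at hlog
  have hfa := mul_le_mul_of_nonneg_left (mul_log_sub_le_log_factorial_s3 hn1 a)
    (by positivity : (0 : ℝ) ≤ d)
  have hfq := mul_le_mul_of_nonneg_left (mul_log_sub_le_log_factorial_s3 hn1 q)
    (by positivity : (0 : ℝ) ≤ (d * d : ℕ))
  push_cast at hlog hfq
  have hL0 : 0 ≤ Real.log n := Real.log_nonneg hn'
  have hLn : Real.log n ≤ n := (Real.log_le_sub_one_of_pos (by linarith)).trans (by linarith)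
  have hexp : logRate d c * n - (2 * d + 1) * (d * (d - 1) / 2) ≤ d * a + d * d * q := by
    have h1 : (d : ℝ) * a + d * d * q = d * n / 2 - a * (d * (d - 1) / 2) := by
      linear_combination (d / 2 : ℝ) * haq'
    have h2 : (a : ℝ) * (d * (d - 1) / 2) ≤ (c * n / (d + 1) + 1 + 2 * d) * (d * (d - 1) / 2) :=
      mul_le_mul_of_nonneg_right (by linarith)
        (div_nonneg (mul_nonneg (by linarith) (by linarith)) (by norm_num))
    have h3 : logRate d c * n = d * n / 2 - c * n / (d + 1) * (d * (d - 1) / 2) := by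
      unfold logRate
      field_simp
    linarith
  have h1 := mul_le_mul_of_nonneg_right hexp hL0
  have h2 : (2 * d + 1) * (d * (d - 1) / 2) * Real.log n ≤
      (2 * (d : ℝ) + 1) * (d * (d - 1) / 2) * n :=
    mul_le_mul_of_nonneg_left hLn (mul_nonneg (by positivity)
      (div_nonneg (mul_nonneg (by linarith) (by linarith)) (by norm_num)))
  linarith

lemma eventually_abs_log_card_Gdc_sub_le {d : ℕ} (hd : 1 ≤ d) {c : ℝ} (hc0 : 0 ≤ c)
    (hc1 : c < 1) :
    ∃ K : ℝ, ∀ᶠ n : ℕ in atTop ⊓ 𝓟 {n : ℕ | Even (n * d)}, 0 < Nat.card (Gdc n d c) ∧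
      |Real.log (Nat.card (Gdc n d c)) - logRate d c * n * Real.log n| ≤ K * n := by
  obtain ⟨K, hK⟩ := eventually_le_log_card_Gdc hd hc0 hc1
  refine ⟨max K (d * Real.log ((d : ℝ) ^ 2) + 1 + d * d * Real.log (d + 1)), ?_⟩
  filter_upwards [hK, (eventually_ge_atTop 1).filter_mono inf_le_left] with n ⟨hpos, hlow⟩ hn
  refine ⟨hpos, abs_le.2 ⟨?_, ?_⟩⟩
  · have := mul_le_mul_of_nonneg_right (le_max_left K
      (d * Real.log ((d : ℝ) ^ 2) + 1 + d * d * Real.log (d + 1))) (Nat.cast_nonneg (α := ℝ) n)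
    linarith
  · have := mul_le_mul_of_nonneg_right (le_max_right K
      (d * Real.log ((d : ℝ) ^ 2) + 1 + d * d * Real.log (d + 1))) (Nat.cast_nonneg (α := ℝ) n)
    linarith [log_card_Gdc_le hd hc0 hc1.le hn hpos]

lemma Gdc_zero (n d : ℕ) : Gdc n d 0 = Gd n d := by
  ext G
  simp [Gdc, Gd]

/-- Large deviations rate, fixed `d`: for fixed `d ≥ 3` and `c ∈ (0,1)`, as `n → ∞` along
integers with `n*d` even,
`(-log(|G_{d,c}(n)|/|G_d(n)|)) / ((dn/2) log(n/(d+1))) → c (d-1)/(d+1)`. -/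
theorem large_deviation_fixed_d (d : ℕ) (hd : 3 ≤ d) (c : ℝ) (hc0 : 0 < c) (hc1 : c < 1) :
    Tendsto
      (fun n : ℕ =>
        (-Real.log ((Nat.card (Gdc n d c) : ℝ) / (Nat.card (Gd n d) : ℝ))) /
          (((d : ℝ) * n / 2) * Real.log ((n : ℝ) / ((d : ℝ) + 1))))
      (atTop ⊓ 𝓟 {n : ℕ | Even (n * d)})
      (nhds (c * ((d : ℝ) - 1) / ((d : ℝ) + 1))) := by
  have hd1 : 1 ≤ d := by omega
  have hd0 : (0 : ℝ) < d := by exact_mod_cast hd1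
  obtain ⟨K, hK⟩ := eventually_abs_log_card_Gdc_sub_le hd1 hc0.le hc1
  obtain ⟨K₀, hK₀⟩ := eventually_abs_log_card_Gdc_sub_le hd1 le_rfl zero_lt_one
  set γ : ℝ := c * ((d : ℝ) - 1) / ((d : ℝ) + 1) with hγ
  have hlim : Tendsto (fun n : ℕ => Real.log ((n : ℝ) / ((d : ℝ) + 1)))
      (atTop ⊓ 𝓟 {n : ℕ | Even (n * d)}) atTop :=
    (Real.tendsto_log_atTop.comp (tendsto_natCast_atTop_atTop.atTop_div_const
      (by positivity))).mono_left inf_le_left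
  rw [← tendsto_sub_nhds_zero_iff]
  refine squeeze_zero_norm' (a := fun n : ℕ =>
    (|γ| * Real.log (d + 1) + 2 * (K + K₀) / d) / Real.log ((n : ℝ) / ((d : ℝ) + 1))) ?_
    (hlim.const_div_atTop _)
  filter_upwards [hK, hK₀, hlim.eventually_gt_atTop 0,
    (eventually_ge_atTop 1).filter_mono inf_le_left] with n ⟨hpos, hn⟩ ⟨hpos₀, hn₀⟩ hl hn1
  rw [Gdc_zero] at hpos₀ hn₀
  have hn' : (0 : ℝ) < n := by exact_mod_cast hn1
  rw [Real.log_div (by exact_mod_cast hpos.ne') (by exact_mod_cast hpos₀.ne')]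
  set A := Real.log (Nat.card (Gdc n d c))
  set B := Real.log (Nat.card (Gd n d))
  set l := Real.log ((n : ℝ) / ((d : ℝ) + 1)) with hldef
  have hl' : Real.log n = l + Real.log (d + 1) := by
    rw [hldef, Real.log_div (by positivity) (by positivity)]
    ring
  set E := A - logRate d c * n * Real.log n
  set E₀ := B - logRate d 0 * n * Real.log n
  have hmain : -(A - B) / (d * n / 2 * l) - γ =
      (γ * Real.log (d + 1) + 2 * (E₀ - E) / (d * n)) / l := by
    have hAB : -(A - B) = d * n / 2 * (γ * (l + Real.log (d + 1))) + (E₀ - E) := by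
      rw [← hl']
      simp only [E, E₀, logRate, hγ]
      ring
    rw [hAB]
    field_simp
    ring
  rw [hmain, Real.norm_eq_abs, abs_div, abs_of_pos hl]
  gcongr
  have hlogd : 0 ≤ Real.log ((d : ℝ) + 1) := Real.log_nonneg (by linarith)
  have hE : |E₀ - E| ≤ (K + K₀) * n := (abs_sub _ _).trans (by linarith)
  refine (abs_add_le _ _).trans (add_le_add ?_ ?_)
  · rw [abs_mul, abs_of_nonneg hlogd]
  · rw [abs_div, abs_mul, abs_two, abs_of_pos (by positivity : (0 : ℝ) < d * n),
      div_le_div_iff₀ (by positivity) hd0]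
    nlinarith [mul_le_mul_of_nonneg_right hE hd0.le]
end
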